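/- arXiv:2406.09059 — 2 statements merged into one kernel-verified Lean document; each statement's English description precedes it below -/
import Mathlib

section
/- Let t ≥ 2 be an even integer. Then for every T ∈ ℂ and every q ∈ ℂ with |q| < 1, Σ_{n≥0} sc_t(n;T) q^n = ∏_{m≥0} (1 + q^{2m+1}) · ∏_{m≥1} (1 − (1 − T²) q^{2tm})^{t/2}, where the series on the left converges absolutely. -/
open scoped Real Classical
open Complex Filter Asymptotics

noncomputable section

/-- The conjugate part `λ'_k`: the number of parts of `P` that are at least `k`. -/
def colLen {n : ℕ} (P : n.Partition) (k : ℕ) : ℕ :=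
  Multiset.card (P.parts.filter (fun p => k ≤ p))

/-- The part `λ_j` (the `j`-th largest part, 1-indexed), recovered by conjugating twice. -/
def rowLen {n : ℕ} (P : n.Partition) (j : ℕ) : ℕ :=
  ((Finset.Icc 1 n).filter (fun k => j ≤ colLen P k)).card

/-- The hook number `h(j,k) = (λ_j - j) + (λ'_k - k) + 1` of the cell `(j,k)` (1-indexed). -/
def hookNum {n : ℕ} (P : n.Partition) (j k : ℕ) : ℤ :=
  ((rowLen P j : ℤ) - j) + ((colLen P k : ℤ) - k) + 1

/-- `N_t(λ)`: the number of cells of the Young diagram of `λ` with hook number `t`. -/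
def Nhook {n : ℕ} (t : ℕ) (P : n.Partition) : ℕ :=
  (((Finset.Icc 1 n) ×ˢ (Finset.Icc 1 n)).filter
    (fun c => c.2 ≤ rowLen P c.1 ∧ hookNum P c.1 c.2 = (t : ℤ))).card

/-- A partition is self-conjugate if `λ_k = λ'_k` for all `k ≥ 1`. -/
def IsSelfConjugate {n : ℕ} (P : n.Partition) : Prop :=
  ∀ k, 1 ≤ k → rowLen P k = colLen P k

/-- `SC(n)`, the set of self-conjugate partitions of `n`. -/
def SC (n : ℕ) : Finset (Nat.Partition n) :=
  Finset.univ.filter (fun P => IsSelfConjugate P)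

/-- `δ_t = 1` if `t` is odd, else `0`. -/
def delta (t : ℕ) : ℝ := if Odd t then 1 else 0

/-- The region `D_θ = { r e^{iα} : r ≥ 0, |α| ≤ θ }`. -/
def Dset (θ : ℝ) : Set ℂ := {z | z = 0 ∨ |z.arg| ≤ θ}

/-- The filter of punctured neighborhoods of `0` intersected with `D_θ`. -/
def near0 (θ : ℝ) : Filter ℂ := nhdsWithin 0 (Dset θ \ {0})

/-- The dilogarithm `Li₂(X) = -∫₀¹ log(1 - Xu)/u du` (principal logarithm). -/
def Li2 (X : ℂ) : ℂ := -∫ u in (0:ℝ)..1, Complex.log (1 - X * u) / (u : ℂ)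

/-- The real dilogarithm, for real arguments `x < 1`. -/
def Li2R (x : ℝ) : ℝ := -∫ u in (0:ℝ)..1, Real.log (1 - x * u) / u

/-- The principal complex square root. -/
def csqrt (z : ℂ) : ℂ := z ^ ((1:ℂ)/2)

/-- The infinite Pochhammer symbol `(a;q)_∞ = ∏_{j ≥ 0} (1 - a q^j)`. -/
def pochInf (a q : ℂ) : ℂ := ∏' j : ℕ, (1 - a * q ^ j)

/-- The finite Pochhammer symbol `(a;q)_n = ∏_{j=0}^{n-1} (1 - a q^j)`. -/
def pochN (a q : ℂ) (n : ℕ) : ℂ := ∏ j ∈ Finset.range n, (1 - a * q ^ j)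

/-- `C_T^+ = 1 + √((1-T)/(1+T))`. -/
def Cp (T : ℝ) : ℂ := 1 + csqrt ((1 - (T:ℂ)) / (1 + (T:ℂ)))

/-- `C_T^- = 1 - √((1-T)/(1+T))`. -/
def Cm (T : ℝ) : ℂ := 1 - csqrt ((1 - (T:ℂ)) / (1 + (T:ℂ)))

/-- `H*(T;q) = (1/(2T)) [ C_T^+ (√(1-T²);-q)_∞ + C_T^- (-√(1-T²);-q)_∞ ]`. -/
def Hstar (T : ℝ) (q : ℂ) : ℂ :=
  1 / (2 * (T:ℂ)) * (Cp T * pochInf (csqrt (1 - (T:ℂ)^2)) (-q)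
    + Cm T * pochInf (-csqrt (1 - (T:ℂ)^2)) (-q))

/-- `α_T^+ = (1/(2T)) ( C_T^+ + C_T^- √((1+√(1-T²))/(1-√(1-T²))) )`. -/
def alphaP (T : ℝ) : ℂ :=
  1 / (2 * (T:ℂ)) *
    (Cp T + Cm T * csqrt ((1 + csqrt (1 - (T:ℂ)^2)) / (1 - csqrt (1 - (T:ℂ)^2))))

/-- `α_T^- = (1/(2T)) ( C_T^+ - C_T^- √((1+√(1-T²))/(1-√(1-T²))) )`. -/
def alphaM (T : ℝ) : ℂ :=
  1 / (2 * (T:ℂ)) *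
    (Cp T - Cm T * csqrt ((1 + csqrt (1 - (T:ℂ)^2)) / (1 - csqrt (1 - (T:ℂ)^2))))

/-- `b_t(T)` from Proposition: saddle-point constant. -/
def bt (t : ℕ) (T : ℝ) : ℝ :=
  if Even t then (1/2) * Real.sqrt (π^2/6 - Li2R (1 - T^2))
  else (1/2) * Real.sqrt (π^2/6 - ((t-1 : ℝ)/t) * Li2R (1 - T^2))

end

/-- The coefficients of `∑ₙ x ^ (n choose 2) (v x; x)ₙ / (x; x)ₙ zⁿ`. -/
noncomputable def qCoeff (x v : ℂ) : ℕ → ℂ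
  | 0 => 1
  | n + 1 => x ^ n * (1 - v * x ^ (n + 1)) / (1 - x ^ (n + 1)) * qCoeff x v n

/-- The series `∑ₙ x ^ (n choose 2) (v x; x)ₙ / (x; x)ₙ zⁿ`. -/
noncomputable def qSeries (x v z : ℂ) : ℂ := ∑' n, qCoeff x v n * z ^ n

/-- A majorant of `‖qCoeff x v n‖` for `‖x‖ = r < 1` and `‖v‖ ≤ V`. -/
noncomputable def qBound (r V : ℝ) : ℕ → ℝ
  | 0 => 1
  | n + 1 => r ^ n * ((1 + V) / (1 - r)) * qBound r V n

lemma one_sub_pow_ne_zero {x : ℂ} (hx : ‖x‖ < 1) (n : ℕ) : 1 - x ^ (n + 1) ≠ 0 := by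
  intro h
  have h1 : ‖x ^ (n + 1)‖ = 1 := by rw [← sub_eq_zero.mp h]; simp
  rw [norm_pow] at h1
  exact (pow_lt_one₀ (norm_nonneg x) hx n.succ_ne_zero).ne h1

lemma qBound_nonneg {r V : ℝ} (hr : 0 ≤ r) (hr1 : r < 1) (hV : 0 ≤ V) (n : ℕ) :
    0 ≤ qBound r V n := by
  induction n with
  | zero => simp [qBound]
  | succ n ih =>
    have : 0 < 1 - r := by linarith
    rw [qBound]; positivity

lemma norm_qCoeff_le {x v : ℂ} {V : ℝ} (hx : ‖x‖ < 1) (hv : ‖v‖ ≤ V) (n : ℕ) :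
    ‖qCoeff x v n‖ ≤ qBound ‖x‖ V n := by
  have hV : 0 ≤ V := (norm_nonneg v).trans hv
  induction n with
  | zero => simp [qCoeff, qBound]
  | succ n ih =>
    have hp : ‖x‖ ^ (n + 1) ≤ ‖x‖ := pow_le_of_le_one (norm_nonneg x) hx.le n.succ_ne_zero
    have hd : 1 - ‖x‖ ≤ ‖1 - x ^ (n + 1)‖ := by
      have := norm_sub_norm_le (1 : ℂ) (x ^ (n + 1))
      rw [norm_one, norm_pow] at this
      linarith
    have hn : ‖1 - v * x ^ (n + 1)‖ ≤ 1 + V := by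
      refine (norm_sub_le _ _).trans ?_
      rw [norm_one, norm_mul, norm_pow]
      have : ‖v‖ * ‖x‖ ^ (n + 1) ≤ V * 1 :=
        mul_le_mul hv (hp.trans hx.le) (by positivity) hV
      linarith
    have h0 : 0 < 1 - ‖x‖ := by linarith
    rw [qCoeff, qBound, norm_mul, norm_div, norm_mul, norm_pow, mul_div_assoc]
    gcongr

lemma summable_qBound {r V : ℝ} (hr : 0 ≤ r) (hr1 : r < 1) (hV : 0 ≤ V) (R : ℝ) (hR : 0 ≤ R) :
    Summable fun n => qBound r V n * R ^ n := by
  have hlim : Tendsto (fun n : ℕ => r ^ n * ((1 + V) / (1 - r)) * R) atTop (nhds 0) := by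
    simpa using ((tendsto_pow_atTop_nhds_zero_of_lt_one hr hr1).mul_const
      ((1 + V) / (1 - r))).mul_const R
  refine summable_of_ratio_norm_eventually_le (r := 1 / 2) (by norm_num) ?_
  filter_upwards [hlim.eventually (ge_mem_nhds (by norm_num : (0 : ℝ) < 1 / 2))] with n hn
  have hb := qBound_nonneg hr hr1 hV n
  have hb' := qBound_nonneg hr hr1 hV (n + 1)
  rw [Real.norm_of_nonneg (by positivity), Real.norm_of_nonneg (by positivity), qBound]
  calc r ^ n * ((1 + V) / (1 - r)) * qBound r V n * R ^ (n + 1)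
      = (r ^ n * ((1 + V) / (1 - r)) * R) * (qBound r V n * R ^ n) := by ring
    _ ≤ 1 / 2 * (qBound r V n * R ^ n) := by gcongr

lemma summable_qCoeff {x : ℂ} (hx : ‖x‖ < 1) (v z : ℂ) :
    Summable fun n => qCoeff x v n * z ^ n := by
  refine Summable.of_norm_bounded
    (summable_qBound (norm_nonneg x) hx (norm_nonneg v) ‖z‖ (norm_nonneg z)) fun n => ?_
  rw [norm_mul, norm_pow]
  gcongr
  exact norm_qCoeff_le hx le_rfl n

lemma qSeries_sub_qSeries {x : ℂ} (hx : ‖x‖ < 1) (v z : ℂ) :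
    qSeries x v z - qSeries x v (z * x) =
      z * (qSeries x v (z * x) - v * x * qSeries x v (z * x ^ 2)) := by
  have s := summable_qCoeff hx v
  simp only [qSeries]
  rw [← (s z).tsum_sub (s (z * x)), ← tsum_mul_left, ← (s (z * x)).tsum_sub ((s _).mul_left _),
    ← tsum_mul_left, ((s z).sub (s (z * x))).tsum_eq_zero_add]
  simp only [pow_zero, sub_self, zero_add]
  refine tsum_congr fun n => ?_
  have := one_sub_pow_ne_zero hx n
  rw [qCoeff]
  field_simp
  ring

lemma qCoeff_mul_one_sub (x v : ℂ) (n : ℕ) :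
    qCoeff x v n * (1 - v * x ^ (n + 1)) = (1 - v * x) * qCoeff x (v * x) n := by
  induction n with
  | zero => simp [qCoeff]
  | succ n ih =>
    rw [qCoeff, qCoeff]
    linear_combination x ^ n * (1 - v * x ^ (n + 2)) / (1 - x ^ (n + 1)) * ih

lemma qSeries_contiguous {x : ℂ} (hx : ‖x‖ < 1) (v z : ℂ) :
    qSeries x v z - v * x * qSeries x v (z * x) = (1 - v * x) * qSeries x (v * x) z := by
  have s := summable_qCoeff hx v
  simp only [qSeries]
  rw [← tsum_mul_left, ← (s z).tsum_sub ((s _).mul_left _), ← tsum_mul_left]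
  refine tsum_congr fun n => ?_
  linear_combination z ^ n * qCoeff_mul_one_sub x v n

/-- The generating function of one pair of runners. -/
noncomputable def qPair (x v z w : ℂ) : ℂ :=
  qSeries x v z * qSeries x v w - v * x * (qSeries x v (z * x) * qSeries x v (w * x))

lemma qPair_step {x : ℂ} (hx : ‖x‖ < 1) (v : ℂ) {z w : ℂ} (hzw : z * w = x) :
    qPair x v z w = (1 - v * x) * qPair x (v * x) z w := by
  have a1 := qSeries_contiguous hx v z
  have a2 := qSeries_contiguous hx v w
  have b1 : (1 - v * x) * (z * qSeries x (v * x) (z * x)) =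
      qSeries x v z - qSeries x v (z * x) := by
    rw [qSeries_sub_qSeries hx, pow_two, ← mul_assoc z]
    linear_combination -z * qSeries_contiguous hx v (z * x)
  have b2 : (1 - v * x) * (w * qSeries x (v * x) (w * x)) =
      qSeries x v w - qSeries x v (w * x) := by
    rw [qSeries_sub_qSeries hx, pow_two, ← mul_assoc w]
    linear_combination -w * qSeries_contiguous hx v (w * x)
  by_cases h : 1 - v * x = 0
  · rw [h, zero_mul] at a1 a2 ⊢
    have hv : v * x = 1 := by linear_combination -h
    rw [hv, one_mul, sub_eq_zero] at a1 a2
    rw [qPair, hv, a1, a2]; ring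
  · refine mul_left_cancel₀ h ?_
    unfold qPair
    have e1 := congrArg₂ (· * ·) a1 a2
    have e2 := congrArg₂ (· * ·) b1 b2
    linear_combination e1 + v * x * e2 -
      v * x * (1 - v * x) ^ 2 * qSeries x (v * x) (z * x) * qSeries x (v * x) (w * x) * hzw

lemma tendsto_qSeries_zero {x : ℂ} (hx : ‖x‖ < 1) (v z : ℂ) :
    Tendsto (fun K : ℕ => qSeries x (v * x ^ K) z) atTop (nhds (qSeries x 0 z)) := by
  have hv : Tendsto (fun K : ℕ => v * x ^ K) atTop (nhds 0) := by
    simpa using (tendsto_pow_atTop_nhds_zero_of_norm_lt_one hx).const_mul v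
  refine tendsto_tsum_of_dominated_convergence
    (summable_qBound (norm_nonneg x) hx (norm_nonneg v) ‖z‖ (norm_nonneg z)) (fun n => ?_)
    (Eventually.of_forall fun K n => ?_)
  · refine Tendsto.mul_const _ ?_
    induction n with
    | zero => simp [qCoeff]
    | succ n ih =>
      simp only [qCoeff]
      exact (((tendsto_const_nhds.sub (hv.mul_const _)).const_mul _).div_const _).mul ih
  · rw [norm_mul, norm_pow]
    gcongr
    refine norm_qCoeff_le hx ?_ n
    rw [norm_mul, norm_pow]
    exact mul_le_of_le_one_right (norm_nonneg v) (pow_le_one₀ (norm_nonneg x) hx.le)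

lemma multipliable_one_sub_mul_pow {x : ℂ} (hx : ‖x‖ < 1) (v : ℂ) :
    Multipliable fun m : ℕ => 1 - v * x ^ (m + 1) := by
  have : Summable fun m : ℕ => ‖-(v * x ^ (m + 1))‖ := by
    simp only [norm_neg, norm_mul, norm_pow]
    exact ((summable_nat_add_iff 1).mpr
      (summable_geometric_of_lt_one (norm_nonneg x) hx)).mul_left _
  simpa [sub_eq_add_neg] using multipliable_one_add_of_summable this

lemma qPair_eq {x : ℂ} (hx : ‖x‖ < 1) (v : ℂ) {z w : ℂ} (hzw : z * w = x) :
    qPair x v z w = (∏' m : ℕ, (1 - v * x ^ (m + 1))) * qPair x 0 z w := by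
  have hK : ∀ K : ℕ, qPair x v z w =
      (∏ m ∈ Finset.range K, (1 - v * x ^ (m + 1))) * qPair x (v * x ^ K) z w := by
    intro K
    induction K with
    | zero => simp
    | succ K ih =>
      rw [ih, qPair_step hx _ hzw, Finset.prod_range_succ]
      ring_nf
  have hv : Tendsto (fun K : ℕ => v * x ^ K) atTop (nhds 0) := by
    simpa using (tendsto_pow_atTop_nhds_zero_of_norm_lt_one hx).const_mul v
  have hlim : Tendsto (fun K : ℕ => qPair x (v * x ^ K) z w) atTop (nhds (qPair x 0 z w)) :=
    ((tendsto_qSeries_zero hx v z).mul (tendsto_qSeries_zero hx v w)).sub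
      ((hv.mul_const x).mul ((tendsto_qSeries_zero hx v (z * x)).mul
        (tendsto_qSeries_zero hx v (w * x))))
  refine tendsto_nhds_unique tendsto_const_nhds
    (((multipliable_one_sub_mul_pow hx v).hasProd.tendsto_prod_nat.mul hlim).congr
      fun K => (hK K).symm)

lemma norm_qSeries_sub_one_le {x : ℂ} (hx : ‖x‖ < 1) (v : ℂ) {R : ℝ} (hR : 0 ≤ R) :
    ∃ K : ℝ, 0 ≤ K ∧ ∀ z : ℂ, ‖z‖ ≤ R → ‖qSeries x v z - 1‖ ≤ K * ‖z‖ := by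
  have hs : Summable fun n => ‖qCoeff x v (n + 1)‖ * R ^ n := by
    by_cases hR0 : R = 0
    · subst hR0
      refine summable_of_ne_finset_zero (s := {0}) fun n hn => ?_
      simp at hn; simp [hn]
    have := (summable_nat_add_iff 1).mpr (summable_qCoeff hx v R).norm
    refine (this.mul_right R⁻¹).congr fun n => ?_
    rw [norm_mul, norm_pow, Complex.norm_of_nonneg hR, pow_succ]
    field_simp
  refine ⟨∑' n, ‖qCoeff x v (n + 1)‖ * R ^ n, tsum_nonneg fun n => by positivity, fun z hz => ?_⟩
  rw [qSeries, (summable_qCoeff hx v z).tsum_eq_zero_add]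
  simp only [qCoeff.eq_1, pow_zero, mul_one, add_sub_cancel_left]
  rw [← tsum_mul_right]
  refine tsum_of_norm_bounded (hs.mul_right _).hasSum fun n => ?_
  rw [norm_mul, norm_pow, pow_succ, mul_assoc]
  gcongr

/-- The weight of a word `f` in `{0, 1}` preceded by the letter `p`: a letter `1` at position `k`
contributes `z x ^ k`, with an extra factor `U` if it follows a letter `0`. -/
noncomputable def wordWeight (x U : ℂ) {M : ℕ} (p : Bool) (z : ℂ) (f : Fin M → Bool) : ℂ :=
  ∏ k : Fin M, if f k then
    z * x ^ (k : ℕ) * (if (Fin.cons p f : Fin (M + 1) → Bool) k.castSucc then 1 else U) else 1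

/-- The sum of the weights of all words of length `M` preceded by the letter `p`. -/
noncomputable def wordSum (x U : ℂ) (p : Bool) (M : ℕ) (z : ℂ) : ℂ :=
  ∑ f : Fin M → Bool, wordWeight x U p z f

lemma wordWeight_cons (x U : ℂ) {M : ℕ} (p b : Bool) (z : ℂ) (f : Fin M → Bool) :
    wordWeight x U p z (Fin.cons b f : Fin (M + 1) → Bool) =
      (if b then z * (if p then 1 else U) else 1) * wordWeight x U b (z * x) f := by
  simp only [wordWeight, Fin.prod_univ_succ, Fin.cons_zero, Fin.cons_succ, Fin.castSucc_zero,
    Fin.castSucc_succ, Fin.val_zero, pow_zero, mul_one, Fin.val_succ, pow_succ']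
  simp only [mul_assoc]

lemma sum_fin_succ_bool {M : ℕ} (F : (Fin (M + 1) → Bool) → ℂ) :
    ∑ f, F f = ∑ f : Fin M → Bool, F (Fin.cons false f) + ∑ f : Fin M → Bool, F (Fin.cons true f) := by
  rw [← (Fin.consEquiv (fun _ => Bool)).sum_comp, Fintype.sum_prod_type, Fintype.sum_bool, add_comm]
  rfl

lemma wordSum_succ (x U : ℂ) (p : Bool) (M : ℕ) (z : ℂ) :
    wordSum x U p (M + 1) z = wordSum x U false M (z * x) +
      z * (if p then 1 else U) * wordSum x U true M (z * x) := by
  simp only [wordSum, sum_fin_succ_bool, wordWeight_cons, Finset.mul_sum]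
  simp

lemma wordSum_zero (x U : ℂ) (p : Bool) (z : ℂ) : wordSum x U p 0 z = 1 := by
  simp [wordSum, wordWeight]

lemma wordSum_false (x v : ℂ) (M : ℕ) (z : ℂ) :
    wordSum x (1 - v) false (M + 1) z =
      wordSum x (1 - v) true (M + 1) z - v * z * wordSum x (1 - v) true M (z * x) := by
  simp only [wordSum_succ, if_true, Bool.false_eq_true, if_false]
  ring

lemma wordSum_true_add_two (x v : ℂ) (M : ℕ) (z : ℂ) :
    wordSum x (1 - v) true (M + 2) z = (1 + z) * wordSum x (1 - v) true (M + 1) (z * x) -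
      v * z * x * wordSum x (1 - v) true M (z * x ^ 2) := by
  rw [wordSum_succ, wordSum_false, if_pos rfl, pow_two, ← mul_assoc z]
  ring

lemma tendsto_zero_of_recurrence {x v : ℂ} (hx : ‖x‖ < 1) {f : ℕ → ℂ → ℂ}
    (hf : ∀ M z, f (M + 2) z = (1 + z) * f (M + 1) (z * x) - v * z * x * f M (z * x ^ 2))
    {K R : ℝ} (hK : 0 ≤ K) (h0 : ∀ z, ‖z‖ ≤ R → ‖f 0 z‖ ≤ K * ‖z‖)
    (h1 : ∀ z, ‖z‖ ≤ R → ‖f 1 z‖ ≤ K * ‖z‖) {z : ℂ} (hz : ‖z‖ ≤ R) :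
    Tendsto (fun M => f M z) atTop (nhds 0) := by
  obtain ⟨s, hxs, hs1⟩ := exists_between hx
  have hs0 : 0 < s := (norm_nonneg x).trans_lt hxs
  have h1s : 0 < 1 - s := by linarith
  set c : ℝ := 1 + ‖v‖ with hc
  have hc0 : 0 < c := by positivity
  have key : ∀ M : ℕ, ∀ z : ℂ, ∀ ρ : ℝ, ‖z‖ ≤ ρ → ρ ≤ R →
      s * ‖f M z‖ ≤ K * ρ * s ^ M * Real.exp (c * ρ / (1 - s)) := by
    intro M
    induction M using Nat.twoStepInduction with
    | zero =>
      intro z ρ hz hρ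
      have hρ0 : 0 ≤ ρ := (norm_nonneg z).trans hz
      have he : 1 ≤ Real.exp (c * ρ / (1 - s)) := Real.one_le_exp (by positivity)
      calc s * ‖f 0 z‖ ≤ 1 * (K * ρ) := by
            gcongr
            exact (h0 z (hz.trans hρ)).trans (by gcongr)
        _ ≤ _ := by
            rw [pow_zero, mul_one, one_mul]
            exact le_mul_of_one_le_right (by positivity) he
    | one =>
      intro z ρ hz hρ
      have hρ0 : 0 ≤ ρ := (norm_nonneg z).trans hz
      have he : 1 ≤ Real.exp (c * ρ / (1 - s)) := Real.one_le_exp (by positivity)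
      calc s * ‖f 1 z‖ ≤ s * (K * ρ) := by
            gcongr
            exact (h1 z (hz.trans hρ)).trans (by gcongr)
        _ = K * ρ * s ^ 1 := by ring
        _ ≤ _ := le_mul_of_one_le_right (by positivity) he
    | more M ih0 ih1 =>
      intro z ρ hz hρ
      have hρ0 : 0 ≤ ρ := (norm_nonneg z).trans hz
      have hzx : ‖z * x‖ ≤ ρ * s := by rw [norm_mul]; gcongr
      have hzx2 : ‖z * x ^ 2‖ ≤ ρ * s ^ 2 := by rw [norm_mul, norm_pow]; gcongr
      have hρs : ρ * s ≤ R := (mul_le_of_le_one_right hρ0 hs1.le).trans hρ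
      have hρs2 : ρ * s ^ 2 ≤ R :=
        (mul_le_of_le_one_right hρ0 (pow_le_one₀ hs0.le hs1.le)).trans hρ
      have i1 := ih1 _ _ hzx hρs
      have hexp : Real.exp (c * (ρ * s ^ 2) / (1 - s)) ≤ Real.exp (c * (ρ * s) / (1 - s)) := by
        gcongr
        nlinarith
      have i0 : s * ‖f M (z * x ^ 2)‖ ≤
          K * (ρ * s ^ 2) * s ^ M * Real.exp (c * (ρ * s) / (1 - s)) :=
        (ih0 _ _ hzx2 hρs2).trans (by gcongr)
      have hexp' : (1 + c * ρ) * Real.exp (c * (ρ * s) / (1 - s)) ≤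
          Real.exp (c * ρ / (1 - s)) := by
        calc _ ≤ Real.exp (c * ρ) * Real.exp (c * (ρ * s) / (1 - s)) := by
              gcongr
              rw [add_comm]
              exact Real.add_one_le_exp _
          _ = _ := by
              rw [← Real.exp_add]
              congr 1
              field_simp
              ring
      have hn : ‖f (M + 2) z‖ ≤
          (1 + ρ) * ‖f (M + 1) (z * x)‖ + ‖v‖ * ρ * s * ‖f M (z * x ^ 2)‖ := by
        rw [hf]
        refine (norm_sub_le _ _).trans ?_
        rw [norm_mul, norm_mul, norm_mul, norm_mul]
        have : ‖1 + z‖ ≤ 1 + ρ := (norm_add_le _ _).trans (by rw [norm_one]; gcongr)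
        gcongr
      calc s * ‖f (M + 2) z‖
          ≤ (1 + ρ) * (s * ‖f (M + 1) (z * x)‖) + ‖v‖ * ρ * s * (s * ‖f M (z * x ^ 2)‖) := by
            nlinarith
        _ ≤ (1 + ρ) * (K * (ρ * s) * s ^ (M + 1) * Real.exp (c * (ρ * s) / (1 - s))) +
            ‖v‖ * ρ * s * (K * (ρ * s ^ 2) * s ^ M * Real.exp (c * (ρ * s) / (1 - s))) := by
            gcongr
        _ = K * ρ * s ^ (M + 2) *
            ((1 + ρ + ‖v‖ * ρ * s) * Real.exp (c * (ρ * s) / (1 - s))) := by ring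
        _ ≤ K * ρ * s ^ (M + 2) * ((1 + c * ρ) * Real.exp (c * (ρ * s) / (1 - s))) := by
            gcongr ?_ * (?_ * ?_)
            have : ‖v‖ * ρ * s ≤ ‖v‖ * ρ := mul_le_of_le_one_right (by positivity) hs1.le
            rw [hc]
            linarith
        _ ≤ _ := by gcongr
  have hlim : Tendsto (fun M : ℕ => s⁻¹ * (K * ‖z‖ * s ^ M * Real.exp (c * ‖z‖ / (1 - s))))
      atTop (nhds 0) := by
    simpa using (((tendsto_pow_atTop_nhds_zero_of_lt_one hs0.le hs1).const_mul
      (K * ‖z‖)).mul_const (Real.exp (c * ‖z‖ / (1 - s)))).const_mul s⁻¹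
  refine squeeze_zero_norm (fun M => ?_) hlim
  rw [← div_eq_inv_mul, le_div_iff₀ hs0, mul_comm]
  exact key M z ‖z‖ le_rfl hz

lemma tendsto_wordSum {x : ℂ} (hx : ‖x‖ < 1) (v z : ℂ) :
    Tendsto (fun M => wordSum x (1 - v) true M z) atTop (nhds (qSeries x v z)) := by
  obtain ⟨K, hK, hb⟩ := norm_qSeries_sub_one_le hx v (norm_nonneg z)
  rw [← tendsto_sub_nhds_zero_iff]
  refine tendsto_zero_of_recurrence (v := v)
    (f := fun M z => wordSum x (1 - v) true M z - qSeries x v z) hx (fun M y => ?_)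
    (K := K + 1) (R := ‖z‖) (by positivity) (fun y hy => ?_) (fun y hy => ?_) le_rfl
  · rw [wordSum_true_add_two]
    linear_combination -qSeries_sub_qSeries hx v y
  · rw [wordSum_zero, norm_sub_rev]
    have := hb y hy
    have := norm_nonneg y
    linarith
  · have h : wordSum x (1 - v) true 1 y - qSeries x v y = y - (qSeries x v y - 1) := by
      rw [wordSum_succ, wordSum_zero, wordSum_zero, if_pos rfl]; ring
    rw [h]
    have := norm_sub_le y (qSeries x v y - 1)
    have := hb y hy
    linarith

/-- The generating function of the pairs of words of length `M + 1` describing a pair of runners,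
the first word being read to the right and the second one to the left of the origin. -/
noncomputable def pairSum (x U z w : ℂ) (M : ℕ) : ℂ :=
  ∑ h : (Fin (M + 1) → Bool) × (Fin (M + 1) → Bool),
    wordWeight x U (!h.2 0) z h.1 * wordWeight x U true w h.2

lemma pairSum_eq (x v z w : ℂ) (M : ℕ) :
    pairSum x (1 - v) z w M =
      wordSum x (1 - v) true (M + 1) z * wordSum x (1 - v) true (M + 1) w -
        v * (z * w) *
          (wordSum x (1 - v) true M (z * x) * wordSum x (1 - v) true M (w * x)) := by
  have h : pairSum x (1 - v) z w M =
      wordSum x (1 - v) true (M + 1) z * wordSum x (1 - v) false M (w * x) +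
      wordSum x (1 - v) false (M + 1) z * (w * wordSum x (1 - v) true M (w * x)) := by
    rw [pairSum, Fintype.sum_prod_type_right, sum_fin_succ_bool]
    simp only [Fin.cons_zero, Bool.not_false, Bool.not_true, ← Finset.sum_mul,
      ← Finset.mul_sum, wordWeight_cons, if_true, Bool.false_eq_true, if_false, one_mul, mul_one]
    rfl
  rw [h, wordSum_false, wordSum_succ _ _ true M w, if_pos rfl]
  ring

lemma tendsto_pairSum {x : ℂ} (hx : ‖x‖ < 1) (v : ℂ) {z w : ℂ} (hzw : z * w = x) :
    Tendsto (fun M => pairSum x (1 - v) z w M) atTop (nhds (qPair x v z w)) := by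
  simp only [pairSum_eq, hzw, qPair]
  exact (((tendsto_wordSum hx v z).comp (tendsto_add_atTop_nat 1)).mul
    ((tendsto_wordSum hx v w).comp (tendsto_add_atTop_nat 1))).sub
      (((tendsto_wordSum hx v _).mul (tendsto_wordSum hx v _)).const_mul _)

/-- For `a` the arm length of a diagonal cell, i.e. an element of the set `D` of arm lengths of the
diagonal cells: `a` (as a bead) does not start a hook of length `t`, when `t ≤ a`; for `a < t` the
condition keeps one bead out of each pair `{a, t - 1 - a}`. -/
def NoHook (t : ℕ) (D : Finset ℕ) (a : ℕ) : Prop :=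
  if a < t then ¬ (a < t / 2 ∧ t - 1 - a ∈ D) else a - t ∈ D

/-- The weight of the self-conjugate partition whose set of diagonal arm lengths is `D`. -/
noncomputable def armWeight (t : ℕ) (q U : ℂ) (D : Finset ℕ) : ℂ :=
  ∏ a ∈ D, q ^ (2 * a + 1) * (if NoHook t D a then 1 else U)

/-- Position `k` on the runner `r` (for `b = false`) or on its mirror image (for `b = true`). -/
def runnerPos (s : ℕ) {N : ℕ} (i : Fin s × Bool × Fin N) : ℕ :=
  2 * s * i.2.2 + (if i.2.1 then 2 * s - 1 - i.1 else i.1)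

lemma runnerPos_injective (s N : ℕ) : Function.Injective (runnerPos s (N := N)) := by
  rintro ⟨r, b, k⟩ ⟨r', b', k'⟩ h
  have hr := r.isLt
  have hr' := r'.isLt
  simp only [runnerPos] at h
  have hc : (if b then 2 * s - 1 - (r : ℕ) else r) < 2 * s := by split_ifs <;> omega
  have hc' : (if b' then 2 * s - 1 - (r' : ℕ) else r') < 2 * s := by split_ifs <;> omega
  have hk : (k : ℕ) = k' := by
    have := congrArg (· / (2 * s)) h
    simpa [Nat.mul_add_div (show 0 < 2 * s by omega), Nat.div_eq_of_lt hc,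
      Nat.div_eq_of_lt hc'] using this
  rw [hk, Nat.add_left_cancel_iff] at h
  have hkk : k = k' := Fin.ext hk
  subst hkk
  cases b <;> cases b' <;> simp only [if_true, Bool.false_eq_true, if_false] at h <;>
    first
    | omega
    | (have : r = r' := Fin.ext (by omega)
       rw [this])

lemma runnerPos_lt (s : ℕ) {N : ℕ} (i : Fin s × Bool × Fin N) : runnerPos s i < 2 * s * N := by
  obtain ⟨r, b, k⟩ := i
  have hr := r.isLt
  have hc : (if b then 2 * s - 1 - (r : ℕ) else r) < 2 * s := by split_ifs <;> omega
  calc runnerPos s (r, b, k) < 2 * s * k + 2 * s := by simpa [runnerPos] using hc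
    _ = 2 * s * (k + 1) := by ring
    _ ≤ 2 * s * N := Nat.mul_le_mul_left _ k.isLt

lemma exists_runnerPos_eq (s : ℕ) {N a : ℕ} (ha : a < 2 * s * N) :
    ∃ i : Fin s × Bool × Fin N, runnerPos s i = a := by
  have hs : 0 < 2 * s := Nat.pos_of_ne_zero fun h => by simp [h] at ha
  have hk : a / (2 * s) < N := Nat.div_lt_of_lt_mul ha
  have hm := Nat.mod_lt a hs
  have hd := Nat.div_add_mod a (2 * s)
  by_cases h : a % (2 * s) < s
  · exact ⟨(⟨a % (2 * s), h⟩, false, ⟨_, hk⟩), by simpa [runnerPos] using hd⟩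
  · refine ⟨(⟨2 * s - 1 - a % (2 * s), by omega⟩, true, ⟨_, hk⟩), ?_⟩
    simp only [runnerPos, if_true]
    omega

/-- The letter of a family of pairs of words at a given position. -/
def letter {s N : ℕ} (h : Fin s → (Fin N → Bool) × (Fin N → Bool))
    (i : Fin s × Bool × Fin N) : Bool :=
  if i.2.1 then (h i.1).2 i.2.2 else (h i.1).1 i.2.2

/-- The set of positions of the letters `1` of a family of pairs of words. -/
noncomputable def beadSet {s N : ℕ} (h : Fin s → (Fin N → Bool) × (Fin N → Bool)) : Finset ℕ :=
  (Finset.univ.filter fun i => letter h i = true).image (runnerPos s)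

lemma mem_beadSet {s N : ℕ} (h : Fin s → (Fin N → Bool) × (Fin N → Bool))
    (i : Fin s × Bool × Fin N) : runnerPos s i ∈ beadSet h ↔ letter h i = true := by
  simp [beadSet, (runnerPos_injective s N).eq_iff]

lemma noHook_beadSet_false {s M : ℕ}
    (h : Fin s → (Fin (M + 1) → Bool) × (Fin (M + 1) → Bool)) (r : Fin s) (k : Fin (M + 1)) :
    NoHook (2 * s) (beadSet h) (runnerPos s (r, false, k)) ↔
      (Fin.cons (!(h r).2 0) (h r).1 : Fin (M + 2) → Bool) k.castSucc = true := by
  have hr := r.isLt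
  induction k using Fin.cases with
  | zero =>
    have h1 : runnerPos s (r, false, (0 : Fin (M + 1))) = r := by simp [runnerPos]
    have h2 : 2 * s - 1 - (r : ℕ) = runnerPos s (r, true, (0 : Fin (M + 1))) := by
      simp [runnerPos]
    rw [h1, NoHook, if_pos (by omega), h2, mem_beadSet]
    simp [letter]
  | succ k =>
    have h1 : runnerPos s (r, false, k.succ) = runnerPos s (r, false, k.castSucc) + 2 * s := by
      simp [runnerPos]; ring
    rw [h1, NoHook, if_neg (by omega), Nat.add_sub_cancel, mem_beadSet]
    simp [letter, Fin.castSucc_succ]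

lemma noHook_beadSet_true {s M : ℕ}
    (h : Fin s → (Fin (M + 1) → Bool) × (Fin (M + 1) → Bool)) (r : Fin s) (k : Fin (M + 1)) :
    NoHook (2 * s) (beadSet h) (runnerPos s (r, true, k)) ↔
      (Fin.cons true (h r).2 : Fin (M + 2) → Bool) k.castSucc = true := by
  have hr := r.isLt
  induction k using Fin.cases with
  | zero =>
    have h1 : runnerPos s (r, true, (0 : Fin (M + 1))) = 2 * s - 1 - r := by simp [runnerPos]
    rw [h1, NoHook, if_pos (by omega)]
    have : ¬ 2 * s - 1 - (r : ℕ) < 2 * s / 2 := by omega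
    simp only [this, false_and, not_false_eq_true, Fin.castSucc_zero, Fin.cons_zero]
  | succ k =>
    have h1 : runnerPos s (r, true, k.succ) = runnerPos s (r, true, k.castSucc) + 2 * s := by
      simp [runnerPos]; ring
    rw [h1, NoHook, if_neg (by omega), Nat.add_sub_cancel, mem_beadSet]
    simp [letter, Fin.castSucc_succ]

lemma prod_beadSet {s N : ℕ} (h : Fin s → (Fin N → Bool) × (Fin N → Bool)) (F : ℕ → ℂ) :
    ∏ a ∈ beadSet h, F a =
      ∏ i : Fin s × Bool × Fin N, if letter h i then F (runnerPos s i) else 1 := by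
  rw [beadSet, Finset.prod_image (runnerPos_injective s _).injOn, Finset.prod_filter]

lemma armWeight_beadSet {s M : ℕ} (q U : ℂ)
    (h : Fin s → (Fin (M + 1) → Bool) × (Fin (M + 1) → Bool)) :
    armWeight (2 * s) q U (beadSet h) = ∏ r : Fin s,
      (wordWeight (q ^ (2 * (2 * s))) U (!(h r).2 0) (q ^ (2 * (r : ℕ) + 1)) (h r).1 *
        wordWeight (q ^ (2 * (2 * s))) U true (q ^ (2 * (2 * s - 1 - (r : ℕ)) + 1)) (h r).2) := by
  rw [armWeight, prod_beadSet, Fintype.prod_prod_type]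
  refine Finset.prod_congr rfl fun r _ => ?_
  rw [Fintype.prod_prod_type, Fintype.prod_bool, mul_comm]
  congr 1 <;> refine Finset.prod_congr rfl fun k _ => ?_
  · simp only [noHook_beadSet_false]
    simp only [letter, Bool.false_eq_true, if_false, runnerPos]
    congr 2
    rw [← pow_mul, ← pow_add]
    ring_nf
  · simp only [noHook_beadSet_true]
    simp only [letter, if_true, runnerPos]
    congr 2
    rw [← pow_mul, ← pow_add]
    ring_nf

lemma sum_powerset_armWeight (s M : ℕ) (q U : ℂ) :
    ∑ D ∈ (Finset.range (2 * s * (M + 1))).powerset, armWeight (2 * s) q U D =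
      ∏ r : Fin s, pairSum (q ^ (2 * (2 * s))) U (q ^ (2 * (r : ℕ) + 1))
        (q ^ (2 * (2 * s - 1 - (r : ℕ)) + 1)) M := by
  simp only [pairSum]
  rw [Finset.prod_univ_sum, Fintype.piFinset_univ]
  symm
  refine Finset.sum_nbij' beadSet
    (fun D r => (fun k => decide (runnerPos s (r, false, k) ∈ D),
      fun k => decide (runnerPos s (r, true, k) ∈ D))) (fun h _ => ?_) (fun _ _ => by simp)
    (fun h _ => ?_) (fun D hD => ?_) (fun h _ => (armWeight_beadSet q U h).symm)
  · rw [Finset.mem_powerset]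
    intro a ha
    obtain ⟨i, -, rfl⟩ := Finset.mem_image.mp ha
    exact Finset.mem_range.mpr (runnerPos_lt s i)
  · funext r
    refine Prod.ext ?_ ?_ <;> funext k <;> simp [mem_beadSet, letter]
  · have hl : ∀ i : Fin s × Bool × Fin (M + 1),
        letter (fun r => (fun k => decide (runnerPos s (r, false, k) ∈ D),
          fun k => decide (runnerPos s (r, true, k) ∈ D))) i = true ↔ runnerPos s i ∈ D := by
      rintro ⟨r, b, k⟩
      cases b <;> simp [letter]
    ext a
    constructor
    · intro ha
      obtain ⟨i, hi, rfl⟩ := Finset.mem_image.mp ha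
      exact (hl i).mp (Finset.mem_filter.mp hi).2
    · intro ha
      obtain ⟨i, rfl⟩ := exists_runnerPos_eq s
        (Finset.mem_range.mp (Finset.mem_powerset.mp hD ha))
      exact (mem_beadSet _ i).mpr ((hl i).mpr ha)

lemma summable_prod_const_mul_pow {q : ℂ} (hq : ‖q‖ < 1) (C : ℝ) :
    Summable fun D : Finset ℕ => ∏ a ∈ D, C * ‖q‖ ^ (2 * a + 1) := by
  refine summable_finsetProd_of_summable_norm (Summable.norm ?_)
  refine Summable.mul_left C ?_
  have h2 : ‖q‖ ^ 2 < 1 := pow_lt_one₀ (norm_nonneg q) hq two_ne_zero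
  refine ((summable_geometric_of_lt_one (by positivity) h2).mul_right ‖q‖).congr fun a => ?_
  rw [pow_succ _ (2 * a), pow_mul]

lemma summable_norm_armWeight (t : ℕ) {q : ℂ} (hq : ‖q‖ < 1) (U : ℂ) :
    Summable fun D => ‖armWeight t q U D‖ := by
  refine Summable.of_nonneg_of_le (fun _ => norm_nonneg _) (fun D => ?_)
    (summable_prod_const_mul_pow hq (max 1 ‖U‖))
  rw [armWeight, norm_prod]
  refine Finset.prod_le_prod (fun _ _ => norm_nonneg _) fun a _ => ?_
  rw [norm_mul, norm_pow, mul_comm]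
  gcongr
  split_ifs <;> simp

lemma tsum_armWeight_eq_prod {s : ℕ} (hs : 0 < s) {q : ℂ} (hq : ‖q‖ < 1) (v : ℂ) :
    ∑' D, armWeight (2 * s) q (1 - v) D =
      ∏ r : Fin s, qPair (q ^ (2 * (2 * s))) v (q ^ (2 * (r : ℕ) + 1))
        (q ^ (2 * (2 * s - 1 - (r : ℕ)) + 1)) := by
  have hx : ‖q ^ (2 * (2 * s))‖ < 1 := by
    rw [norm_pow]
    exact pow_lt_one₀ (norm_nonneg q) hq (by omega)
  have hsum := (summable_norm_armWeight (2 * s) hq (1 - v)).of_norm.hasSum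
  have hR : Tendsto (fun M : ℕ => Finset.range (2 * s * (M + 1))) atTop atTop :=
    tendsto_finset_range.comp (tendsto_atTop_mono (fun M => by simp only [id]; nlinarith) tendsto_id)
  have h1 := hsum.comp (tendsto_finset_powerset_atTop_atTop.comp hR)
  refine tendsto_nhds_unique h1 ?_
  refine Tendsto.congr (fun M => (sum_powerset_armWeight s M q (1 - v)).symm) ?_
  refine tendsto_finsetProd _ fun r _ => tendsto_pairSum hx v ?_
  rw [← pow_add]
  have := r.isLt
  congr 1
  omega

lemma tsum_armWeight {s : ℕ} (hs : 0 < s) {q : ℂ} (hq : ‖q‖ < 1) (v : ℂ) :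
    ∑' D, armWeight (2 * s) q (1 - v) D = (∏' m : ℕ, (1 + q ^ (2 * m + 1))) *
      ∏' m : ℕ, (1 - v * q ^ (2 * (2 * s) * (m + 1))) ^ s := by
  have hx : ‖q ^ (2 * (2 * s))‖ < 1 := by
    rw [norm_pow]
    exact pow_lt_one₀ (norm_nonneg q) hq (by omega)
  have h0 : ∏ r : Fin s, qPair (q ^ (2 * (2 * s))) 0 (q ^ (2 * (r : ℕ) + 1))
      (q ^ (2 * (2 * s - 1 - (r : ℕ)) + 1)) = ∏' m : ℕ, (1 + q ^ (2 * m + 1)) := by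
    rw [← tsum_armWeight_eq_prod hs hq, tprod_one_add]
    · simp [armWeight]
    · refine (summable_norm_armWeight (2 * s) hq 1).of_norm.congr fun D => ?_
      simp [armWeight]
  rw [tsum_armWeight_eq_prod hs hq, ← h0]
  have h1 : ∀ r : Fin s, qPair (q ^ (2 * (2 * s))) v (q ^ (2 * (r : ℕ) + 1))
      (q ^ (2 * (2 * s - 1 - (r : ℕ)) + 1)) = _ := fun r => by
    refine qPair_eq hx v ?_
    rw [← pow_add]
    have := r.isLt
    congr 1
    omega
  rw [Finset.prod_congr rfl fun r _ => h1 r, Finset.prod_mul_distrib, Finset.prod_const,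
    Finset.card_univ, Fintype.card_fin, ← (multipliable_one_sub_mul_pow hx v).tprod_pow, mul_comm]
  simp only [← pow_mul]

lemma lt_card_filter_range {p : ℕ → Prop} [DecidablePred p] {N : ℕ} (hp : ∀ k, p (k + 1) → p k)
    (hN : ∀ k, p k → k < N) (j : ℕ) : j < ((Finset.range N).filter p).card ↔ p j := by
  have hex : ∃ k, ¬ p k := ⟨N, fun h => (hN N h).false⟩
  have hdown : ∀ d k, p (k + d) → p k := by
    intro d
    induction d with
    | zero => exact fun k h => h
    | succ d ih => exact fun k h => ih k (hp _ h)
  have hiff : ∀ k, k < Nat.find hex ↔ p k := by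
    refine fun k => ⟨fun h => not_not.mp (Nat.find_min hex h), fun h => ?_⟩
    by_contra! hk
    obtain ⟨d, rfl⟩ := Nat.exists_eq_add_of_le hk
    exact Nat.find_spec hex (hdown d _ h)
  have : (Finset.range N).filter p = Finset.range (Nat.find hex) := by
    ext k
    simp only [Finset.mem_filter, Finset.mem_range, hiff]
    exact ⟨fun h => h.2, fun h => ⟨hN k h, h⟩⟩
  rw [this, Finset.card_range, hiff]

lemma colLen_antitone {n : ℕ} (P : n.Partition) : Antitone (colLen P) := fun _ _ h =>
  Multiset.card_le_card (Multiset.monotone_filter_right _ fun _ hp => h.trans hp)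

lemma le_of_colLen_pos {n : ℕ} (P : n.Partition) {k : ℕ} (h : 0 < colLen P k) : k ≤ n := by
  obtain ⟨p, hp⟩ := Multiset.card_pos_iff_exists_mem.mp h
  rw [Multiset.mem_filter] at hp
  exact hp.2.trans (P.le_of_mem_parts hp.1)

lemma lt_rowLen_iff {n : ℕ} (P : n.Partition) (i j : ℕ) :
    j < rowLen P (i + 1) ↔ i < colLen P (j + 1) := by
  have h : rowLen P (i + 1) =
      ((Finset.range n).filter fun k => i < colLen P (k + 1)).card := by
    refine (Finset.card_nbij' (· + 1) (· - 1) ?_ ?_ ?_ ?_).symm <;> intro k hk <;>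
      simp only [Finset.coe_filter, Finset.mem_range, Finset.mem_Icc, Set.mem_ofPred_eq] at hk ⊢
    · exact ⟨by omega, hk.2⟩
    · rw [Nat.sub_add_cancel hk.1.1]
      exact ⟨by omega, hk.2⟩
    · omega
    · omega
  rw [h]
  exact lt_card_filter_range (p := fun k => i < colLen P (k + 1))
    (fun k hk => hk.trans_le (colLen_antitone P (Nat.le_succ _)))
    (fun k hk => le_of_colLen_pos P (Nat.zero_lt_of_lt hk)) j

lemma card_filter_le_eq_count_add (s : Multiset ℕ) (k : ℕ) :
    Multiset.card (s.filter (k ≤ ·)) = s.count k + Multiset.card (s.filter (k + 1 ≤ ·)) := by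
  induction s using Multiset.induction with
  | empty => simp
  | cons a s ih =>
    simp only [Multiset.filter_cons, Multiset.card_add, Multiset.count_cons, ih]
    split_ifs <;> simp <;> omega

lemma sum_eq_sum_card_filter (s : Multiset ℕ) {N : ℕ} (h : ∀ p ∈ s, p ≤ N) :
    s.sum = ∑ j ∈ Finset.range N, Multiset.card (s.filter (j + 1 ≤ ·)) := by
  induction s using Multiset.induction with
  | empty => simp
  | cons a s ih =>
    have ha : a ≤ N := h a (Multiset.mem_cons_self a s)
    have hc : ((Finset.range N).filter (· + 1 ≤ a)) = Finset.range a := by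
      ext k
      simp only [Finset.mem_filter, Finset.mem_range]
      omega
    have hcard : ∀ k, Multiset.card ((a ::ₘ s).filter (k + 1 ≤ ·)) =
        (if k + 1 ≤ a then 1 else 0) + Multiset.card (s.filter (k + 1 ≤ ·)) := fun k => by
      rw [Multiset.filter_cons, Multiset.card_add]
      split_ifs <;> simp
    simp only [hcard]
    rw [Finset.sum_add_distrib, ← Finset.card_filter, hc, Finset.card_range, Multiset.sum_cons,
      ih fun p hp => h p (Multiset.mem_cons_of_mem hp)]

lemma partition_eq_of_colLen_eq {n : ℕ} {P P' : n.Partition}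
    (h : ∀ j, colLen P (j + 1) = colLen P' (j + 1)) : P = P' := by
  refine Nat.Partition.ext (Multiset.ext.mpr fun k => ?_)
  cases k with
  | zero =>
    rw [Multiset.count_eq_zero.mpr fun h0 => (P.parts_pos h0).false,
      Multiset.count_eq_zero.mpr fun h0 => (P'.parts_pos h0).false]
  | succ k =>
    have h1 := h k
    have h2 := h (k + 1)
    simp only [colLen] at h1 h2
    rw [card_filter_le_eq_count_add, card_filter_le_eq_count_add P'.parts, h2] at h1
    exact Nat.add_right_cancel h1

/-- The number of elements of `D` that are at least `c`. -/
def countGE (D : Finset ℕ) (c : ℕ) : ℕ := (D.filter (c ≤ ·)).card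

/-- The cells (0-indexed) of the self-conjugate diagram whose diagonal cells have the arm lengths
in `D`. -/
def ArmCell (D : Finset ℕ) (i j : ℕ) : Prop := min i j < countGE D (max i j - min i j)

lemma countGE_eq (D : Finset ℕ) (c : ℕ) :
    countGE D c = countGE D (c + 1) + if c ∈ D then 1 else 0 := by
  have h := card_filter_le_eq_count_add D.val c
  rw [Multiset.count_eq_of_nodup D.nodup] at h
  rw [add_comm]
  exact h

lemma armCell_comm (D : Finset ℕ) (i j : ℕ) : ArmCell D i j ↔ ArmCell D j i := by
  rw [ArmCell, ArmCell, min_comm, max_comm]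

lemma armCell_add_right (D : Finset ℕ) (i c : ℕ) : ArmCell D i (i + c) ↔ i < countGE D c := by
  simp [ArmCell]

lemma armCell_add_left (D : Finset ℕ) (i c : ℕ) : ArmCell D (i + c) i ↔ i < countGE D c := by
  rw [armCell_comm, armCell_add_right]

lemma armCell_of_succ_right {D : Finset ℕ} {i j : ℕ} (h : ArmCell D i (j + 1)) :
    ArmCell D i j := by
  rcases le_or_gt i j with hij | hij
  · obtain ⟨c, rfl⟩ := Nat.exists_eq_add_of_le hij
    rw [add_assoc, armCell_add_right] at h
    rw [armCell_add_right, countGE_eq]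
    omega
  · obtain ⟨c, rfl⟩ := Nat.exists_eq_add_of_lt hij
    rw [add_right_comm, armCell_add_left] at h
    rw [add_assoc, armCell_add_left]
    have := countGE_eq D c
    split_ifs at this <;> omega

lemma countGE_le {D : Finset ℕ} {N : ℕ} (hD : D ⊆ Finset.range N) (c : ℕ) :
    countGE D c ≤ N - c := by
  rw [← Nat.card_Ico]
  refine Finset.card_le_card fun a ha => ?_
  rw [Finset.mem_filter] at ha
  exact Finset.mem_Ico.mpr ⟨ha.2, Finset.mem_range.mp (hD ha.1)⟩

lemma lt_of_armCell {D : Finset ℕ} {N : ℕ} (hD : D ⊆ Finset.range N) {i j : ℕ}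
    (h : ArmCell D i j) : i < N ∧ j < N := by
  have := countGE_le hD (max i j - min i j)
  rw [ArmCell] at h
  omega

lemma sum_countGE {D : Finset ℕ} {N : ℕ} (hD : D ⊆ Finset.range N) (b : ℕ) :
    ∑ c ∈ Finset.range N, countGE D (c + b) = ∑ a ∈ D, (a + 1 - b) := by
  simp only [countGE, Finset.card_filter]
  rw [Finset.sum_comm]
  refine Finset.sum_congr rfl fun a ha => ?_
  have haN := Finset.mem_range.mp (hD ha)
  rw [← Finset.card_filter]
  have : (Finset.range N).filter (· + b ≤ a) = Finset.range (a + 1 - b) := by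
    ext c
    simp only [Finset.mem_filter, Finset.mem_range]
    omega
  rw [this, Finset.card_range]

lemma card_filter_lt_countGE {D : Finset ℕ} {N : ℕ} (hD : D ⊆ Finset.range N) (b : ℕ) :
    ((Finset.range N ×ˢ Finset.range N).filter fun p => p.2 < countGE D (p.1 + b)).card =
      ∑ a ∈ D, (a + 1 - b) := by
  rw [← sum_countGE hD b, Finset.card_filter, Finset.sum_product]
  refine Finset.sum_congr rfl fun c _ => ?_
  rw [← Finset.card_filter]
  have hc := countGE_le hD (c + b)
  have : (Finset.range N).filter (· < countGE D (c + b)) = Finset.range (countGE D (c + b)) := by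
    ext i
    simp only [Finset.mem_filter, Finset.mem_range]
    omega
  rw [this, Finset.card_range]

lemma sum_card_armCell {D : Finset ℕ} {N : ℕ} (hD : D ⊆ Finset.range N) :
    ∑ i ∈ Finset.range N, ((Finset.range N).filter (ArmCell D i)).card =
      ∑ a ∈ D, (2 * a + 1) := by
  have h1 : ((Finset.range N ×ˢ Finset.range N).filter fun p =>
      ArmCell D p.1 p.2 ∧ p.1 ≤ p.2).card = ∑ a ∈ D, (a + 1 - 0) := by
    rw [← card_filter_lt_countGE hD]
    refine Finset.card_nbij' (fun p => (p.2 - p.1, p.1)) (fun p => (p.2, p.2 + p.1)) ?_ ?_ ?_ ?_ <;>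
      rintro ⟨i, j⟩ h <;>
      simp only [Finset.coe_filter, Finset.mem_product, Finset.mem_range, Set.mem_ofPred_eq,
        Prod.mk.injEq] at h ⊢
    · obtain ⟨c, rfl⟩ := Nat.exists_eq_add_of_le h.2.2
      rw [armCell_add_right] at h
      simp only [Nat.add_sub_cancel_left]
      exact ⟨⟨by omega, h.1.1⟩, h.2.1⟩
    · have hc : ArmCell D j (j + i) := (armCell_add_right D j i).mpr h.2
      exact ⟨lt_of_armCell hD hc, hc, by omega⟩
    · exact ⟨trivial, Nat.add_sub_cancel' h.2.2⟩
    · exact ⟨Nat.add_sub_cancel_left _ _, trivial⟩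
  have h2 : ((Finset.range N ×ˢ Finset.range N).filter fun p =>
      ArmCell D p.1 p.2 ∧ ¬ p.1 ≤ p.2).card = ∑ a ∈ D, (a + 1 - 1) := by
    rw [← card_filter_lt_countGE hD]
    refine Finset.card_nbij' (fun p => (p.1 - p.2 - 1, p.2)) (fun p => (p.2 + (p.1 + 1), p.2))
      ?_ ?_ ?_ ?_ <;>
      rintro ⟨i, j⟩ h <;>
      simp only [Finset.coe_filter, Finset.mem_product, Finset.mem_range, Set.mem_ofPred_eq,
        Prod.mk.injEq] at h ⊢
    · have hi : i = j + (i - j - 1 + 1) := by omega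
      rw [hi, armCell_add_left] at h
      exact ⟨⟨by omega, h.1.2⟩, h.2.1⟩
    · have hc : ArmCell D (j + (i + 1)) j := (armCell_add_left D j (i + 1)).mpr h.2
      exact ⟨lt_of_armCell hD hc, hc, by omega⟩
    · exact ⟨by omega, trivial⟩
    · exact ⟨by omega, trivial⟩
  have h3 := Finset.card_filter_add_card_filter_not
    (s := (Finset.range N ×ˢ Finset.range N).filter fun p => ArmCell D p.1 p.2) fun p => p.1 ≤ p.2
  rw [Finset.filter_filter, Finset.filter_filter, h1, h2, ← Finset.sum_add_distrib,
    Finset.card_filter, Finset.sum_product] at h3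
  simp only [Finset.card_filter]
  rw [← h3]
  exact Finset.sum_congr rfl fun a _ => by omega

/-- `P` is the self-conjugate partition whose set of diagonal arm lengths is `D`. -/
def HasArms {n : ℕ} (P : n.Partition) (D : Finset ℕ) : Prop :=
  ∀ i j, i < colLen P (j + 1) ↔ ArmCell D i j

lemma exists_hasArms (D : Finset ℕ) :
    ∃ P : (∑ a ∈ D, (2 * a + 1)).Partition, HasArms P D := by
  obtain ⟨N, hD⟩ : ∃ N, D ⊆ Finset.range N := D.exists_nat_subset_range
  set l : ℕ → ℕ := fun i => ((Finset.range N).filter (ArmCell D i)).card with hl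
  have hlt : ∀ i j, j < l i ↔ ArmCell D i j := fun i =>
    lt_card_filter_range (fun _ => armCell_of_succ_right) fun _ h => (lt_of_armCell hD h).2
  have hsum : ((Finset.range N).val.map l).sum = ∑ a ∈ D, (2 * a + 1) := sum_card_armCell hD
  refine ⟨Nat.Partition.ofSums _ _ hsum, fun i j => ?_⟩
  have hcol : colLen (Nat.Partition.ofSums _ _ hsum) (j + 1) = ((Finset.range N).filter fun i => ArmCell D i j).card := by
    rw [colLen, Nat.Partition.ofSums_parts, Multiset.filter_filter, Multiset.filter_map,
      Multiset.card_map]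
    change (Finset.filter _ (Finset.range N)).card = _
    congr 1
    refine Finset.filter_congr fun i _ => ?_
    rw [← hlt]
    simp only [Function.comp_apply]
    omega
  rw [hcol]
  exact lt_card_filter_range (p := fun i => ArmCell D i j)
    (fun k h => (armCell_comm _ _ _).mp (armCell_of_succ_right ((armCell_comm _ _ _).mp h)))
    (fun _ h => (lt_of_armCell hD h).1) i

namespace HasArms

variable {n : ℕ} {P : n.Partition} {D : Finset ℕ}

lemma rowLen_eq (h : HasArms P D) (i : ℕ) : rowLen P (i + 1) = colLen P (i + 1) :=
  eq_of_forall_lt_iff fun j => by rw [lt_rowLen_iff, h, h, armCell_comm]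

lemma isSelfConjugate (h : HasArms P D) : IsSelfConjugate P := fun k hk => by
  obtain ⟨i, rfl⟩ := Nat.exists_eq_add_of_le' hk
  exact h.rowLen_eq i

lemma colLen_eq_card (h : HasArms P D) {N : ℕ} (hD : D ⊆ Finset.range N) (i : ℕ) :
    colLen P (i + 1) = ((Finset.range N).filter (ArmCell D i)).card :=
  eq_of_forall_lt_iff fun j => by
    rw [h, armCell_comm, lt_card_filter_range (fun _ => armCell_of_succ_right)
      fun _ h => (lt_of_armCell hD h).2]

lemma colLen_unique {n' : ℕ} {P' : n'.Partition} (h : HasArms P D) (h' : HasArms P' D) (i : ℕ) :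
    colLen P (i + 1) = colLen P' (i + 1) :=
  eq_of_forall_lt_iff fun j => by rw [h, h']

lemma partition_unique {P' : n.Partition} (h : HasArms P D) (h' : HasArms P' D) : P = P' :=
  partition_eq_of_colLen_eq (h.colLen_unique h')

lemma sum_eq (h : HasArms P D) : n = ∑ a ∈ D, (2 * a + 1) := by
  obtain ⟨N, hD⟩ : ∃ N, D ⊆ Finset.range N := D.exists_nat_subset_range
  have hD' : D ⊆ Finset.range (max n N) :=
    hD.trans (Finset.range_subset_range.mpr (le_max_right n N))
  rw [← sum_card_armCell hD', ← Finset.sum_congr rfl fun i _ => h.colLen_eq_card hD' i]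
  conv_lhs => rw [← P.parts_sum]
  exact sum_eq_sum_card_filter P.parts fun p hp => (P.le_of_mem_parts hp).trans (le_max_left n N)

lemma arms_unique {D' : Finset ℕ} (h : HasArms P D) (h' : HasArms P D') : D = D' := by
  have hc : ∀ c, countGE D c = countGE D' c := fun c => eq_of_forall_lt_iff fun i => by
    rw [← armCell_add_right, ← armCell_add_right, ← h, ← h']
  ext c
  have h1 := countGE_eq D c
  have h2 := countGE_eq D' c
  rw [hc, hc] at h1
  split_ifs at h1 h2 <;> first | omega | simp_all

end HasArms

lemma IsSelfConjugate.exists_hasArms {n : ℕ} {P : n.Partition} (hP : IsSelfConjugate P) :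
    ∃ D, HasArms P D := by
  have hcomm : ∀ i j, i < colLen P (j + 1) ↔ j < colLen P (i + 1) := fun i j => by
    rw [← hP (i + 1) (Nat.le_add_left 1 i), lt_rowLen_iff]
  have hleft : ∀ i j, i + 1 < colLen P (j + 1) → i < colLen P (j + 1) := fun i j h => by omega
  have hright : ∀ i j, i < colLen P (j + 1 + 1) → i < colLen P (j + 1) := fun i j h =>
    h.trans_le (colLen_antitone P (Nat.le_succ _))
  set d : ℕ → ℕ := fun c => ((Finset.range n).filter fun i => i < colLen P (i + c + 1)).card
  have hd : ∀ c i, i < d c ↔ i < colLen P (i + c + 1) := fun c i =>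
    lt_card_filter_range (p := fun i => i < colLen P (i + c + 1))
      (fun k hk => hright _ _ (hleft _ _ (by rwa [show k + 1 + c = k + c + 1 by ring] at hk)))
      (fun k hk => by have := le_of_colLen_pos P (k := k + c + 1) (Nat.zero_lt_of_lt hk); omega) i
  have hd0 : ∀ c, n ≤ c → d c = 0 := fun c hc => by
    by_contra h
    have := le_of_colLen_pos P (Nat.zero_lt_of_lt ((hd c 0).mp (Nat.pos_of_ne_zero h)))
    omega
  have hd1 : ∀ c, d (c + 1) ≤ d c := fun c =>
    le_of_forall_lt fun i hi => (hd c i).mpr (hright _ _ ((hd (c + 1) i).mp hi))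
  have hd2 : ∀ c, d c ≤ d (c + 1) + 1 := fun c => by
    by_contra! h
    have h3 := (hd c _).mp h
    refine lt_irrefl (d (c + 1)) ((hd (c + 1) _).mpr ?_)
    rw [show d (c + 1) + 1 + c + 1 = d (c + 1) + (c + 1) + 1 by ring] at h3
    omega
  refine ⟨(Finset.range n).filter fun c => d c ≠ d (c + 1), ?_⟩
  set D := (Finset.range n).filter fun c => d c ≠ d (c + 1) with hD
  have hcount : ∀ m c, n ≤ c + m → countGE D c = d c := by
    intro m
    induction m with
    | zero =>
      intro c hc
      have := countGE_le (Finset.filter_subset (fun c => d c ≠ d (c + 1)) (Finset.range n)) c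
      rw [hd0 c hc]
      rw [← hD] at this
      omega
    | succ m ih =>
      intro c hc
      rw [countGE_eq, ih (c + 1) (by omega)]
      have h1 := hd1 c
      have h2 := hd2 c
      by_cases hcn : c < n
      · simp only [hD, Finset.mem_filter, Finset.mem_range, hcn, true_and]
        split_ifs <;> omega
      · have hc0 := hd0 c (by omega)
        have : c ∉ D := fun h => hcn (Finset.mem_range.mp (Finset.mem_filter.mp h).1)
        rw [if_neg this]
        omega
  have hle : ∀ i c, i < colLen P (i + c + 1) ↔ ArmCell D i (i + c) := fun i c => by
    rw [armCell_add_right, hcount n c (by omega), hd]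
  intro i j
  rcases le_total i j with hij | hij
  · obtain ⟨c, rfl⟩ := Nat.exists_eq_add_of_le hij
    exact hle i c
  · obtain ⟨c, rfl⟩ := Nat.exists_eq_add_of_le hij
    rw [hcomm, armCell_comm, hle]

/-- The Maya diagram of the self-conjugate partition whose set of diagonal arm lengths is `D`. -/
def InMaya (D : Finset ℕ) (x : ℤ) : Prop := if 0 ≤ x then x.toNat ∈ D else (-1 - x).toNat ∉ D

lemma inMaya_natCast (D : Finset ℕ) (a : ℕ) : InMaya D a ↔ a ∈ D := by
  simp [InMaya]

lemma inMaya_neg_one_sub (D : Finset ℕ) (x : ℤ) : InMaya D (-1 - x) ↔ ¬ InMaya D x := by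
  by_cases hx : 0 ≤ x
  · rw [InMaya, InMaya, if_pos hx, if_neg (by omega), sub_sub_cancel]
  · rw [InMaya, InMaya, if_neg hx, if_pos (by omega), not_not]

lemma HasArms.lt_colLen_iff {n : ℕ} {P : n.Partition} {D : Finset ℕ} (h : HasArms P D) (i j : ℕ) :
    j < colLen P (i + 1) ↔ ArmCell D i j := by
  rw [h, armCell_comm]

lemma HasArms.exists_colLen_sub_iff {n : ℕ} {P : n.Partition} {D : Finset ℕ} (h : HasArms P D)
    (x : ℤ) : (∃ i : ℕ, (colLen P (i + 1) : ℤ) - (i + 1) = x) ↔ InMaya D x := by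
  by_cases hx : 0 ≤ x
  · obtain ⟨a, rfl⟩ := Int.eq_ofNat_of_zero_le hx
    rw [inMaya_natCast]
    have hlt : ∀ i c, i + c < colLen P (i + 1) ↔ i < countGE D c := fun i c => by
      rw [h.lt_colLen_iff, armCell_add_right]
    have hc := countGE_eq D a
    constructor
    · rintro ⟨i, hi⟩
      by_contra ha
      rw [if_neg ha] at hc
      have h1 := (hlt i a).mp (by omega)
      have h2 := (hlt i (a + 1)).mpr (by omega)
      omega
    · intro ha
      rw [if_pos ha] at hc
      refine ⟨countGE D (a + 1), ?_⟩
      have h1 := (hlt (countGE D (a + 1)) a).mpr (by omega)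
      have h2 := (hlt (countGE D (a + 1)) (a + 1)).not.mpr (by omega)
      omega
  · obtain ⟨a, rfl⟩ : ∃ a : ℕ, x = -1 - a := ⟨(-1 - x).toNat, by omega⟩
    rw [inMaya_neg_one_sub, inMaya_natCast]
    have hlt : ∀ j c, j < colLen P (j + c + 1) ↔ j < countGE D c := fun j c => by
      rw [h.lt_colLen_iff, armCell_add_left]
    have hc := countGE_eq D a
    constructor
    · rintro ⟨i, hi⟩ ha
      rw [if_pos ha] at hc
      obtain ⟨j, rfl⟩ : ∃ j, i = j + a := ⟨i - a, by omega⟩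
      have h1 := (hlt j a).not.mp (by omega)
      rcases Nat.eq_zero_or_pos j with rfl | hj
      · omega
      · obtain ⟨k, rfl⟩ : ∃ k, j = k + 1 := Nat.exists_eq_add_one.mpr hj
        have h2 := hlt k (a + 1)
        rw [show k + (a + 1) + 1 = k + 1 + a + 1 by ring] at h2
        have h3 := h2.mp (by omega)
        omega
    · intro ha
      rw [if_neg ha] at hc
      refine ⟨countGE D a + a, ?_⟩
      have h1 := (hlt (countGE D a) a).not.mpr (by omega)
      rcases Nat.eq_zero_or_pos (countGE D a) with h0 | hj
      · push_cast
        omega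
      · obtain ⟨k, hk⟩ := Nat.exists_eq_add_one.mpr hj
        have h2 := (hlt k (a + 1)).mpr (by omega)
        rw [show k + (a + 1) + 1 = k + 1 + a + 1 by ring] at h2
        rw [hk] at h1 ⊢
        push_cast
        omega

/-- The positions in the Maya diagram that can be moved down by `t`. -/
noncomputable def movable (t : ℕ) (D : Finset ℕ) : Finset ℤ :=
  (D.filter fun a => ¬ NoHook t D a).image (fun a : ℕ => (a : ℤ)) ∪
    (D.filter fun a => ¬ NoHook t D a).image (fun a : ℕ => (t : ℤ) - 1 - a)

lemma card_movable {t : ℕ} (hte : Even t) (D : Finset ℕ) :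
    (movable t D).card = 2 * (D.filter fun a => ¬ NoHook t D a).card := by
  rw [movable, Finset.card_union_of_disjoint, Finset.card_image_of_injective,
    Finset.card_image_of_injective, two_mul]
  · exact fun a b h => by simpa using h
  · exact fun a b h => by simpa using h
  · obtain ⟨s, rfl⟩ := hte
    rw [Finset.disjoint_left]
    simp only [Finset.mem_image, Finset.mem_filter]
    rintro x ⟨a, ⟨-, ha⟩, rfl⟩ ⟨b, ⟨-, hb⟩, hab⟩
    rw [NoHook] at ha hb
    split_ifs at ha hb <;> omega

lemma mem_movable {t : ℕ} (hte : Even t) (D : Finset ℕ) (x : ℤ) :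
    x ∈ movable t D ↔ InMaya D x ∧ InMaya D (t - 1 - x) := by
  obtain ⟨s, rfl⟩ := hte
  simp only [movable, Finset.mem_union, Finset.mem_image, Finset.mem_filter]
  have key : ∀ a : ℕ, a ∈ D ∧ ¬ NoHook (s + s) D a →
      InMaya D a ∧ InMaya D (((s + s : ℕ) : ℤ) - 1 - a) := by
    rintro a ⟨ha, hN⟩
    refine ⟨(inMaya_natCast D a).mpr ha, ?_⟩
    rw [NoHook] at hN
    split_ifs at hN with hat
    · rw [not_not] at hN
      rw [show ((s + s : ℕ) : ℤ) - 1 - a = ((s + s - 1 - a : ℕ) : ℤ) by omega, inMaya_natCast]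
      exact hN.2
    · rw [show ((s + s : ℕ) : ℤ) - 1 - a = -1 - ((a - (s + s) : ℕ) : ℤ) by omega,
        inMaya_neg_one_sub, inMaya_natCast]
      exact hN
  have key' : ∀ x : ℤ, (s : ℤ) ≤ x → InMaya D x → InMaya D (((s + s : ℕ) : ℤ) - 1 - x) →
      ∃ a : ℕ, (a ∈ D ∧ ¬ NoHook (s + s) D a) ∧ (a = x ∨ ((s + s : ℕ) : ℤ) - 1 - a = x) := by
    intro x hx h1 h2
    obtain ⟨a, rfl⟩ := Int.eq_ofNat_of_zero_le (by omega : 0 ≤ x)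
    rw [inMaya_natCast] at h1
    by_cases hat : a < s + s
    · rw [show ((s + s : ℕ) : ℤ) - 1 - a = ((s + s - 1 - a : ℕ) : ℤ) by omega,
        inMaya_natCast] at h2
      refine ⟨s + s - 1 - a, ⟨h2, ?_⟩, Or.inr (by omega)⟩
      rw [NoHook, if_pos (by omega), not_not, show s + s - 1 - (s + s - 1 - a) = a by omega]
      exact ⟨by omega, h1⟩
    · rw [show ((s + s : ℕ) : ℤ) - 1 - a = -1 - ((a - (s + s) : ℕ) : ℤ) by omega,
        inMaya_neg_one_sub, inMaya_natCast] at h2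
      refine ⟨a, ⟨h1, ?_⟩, Or.inl rfl⟩
      rwa [NoHook, if_neg hat]
  constructor
  · rintro (⟨a, ha, rfl⟩ | ⟨a, ha, rfl⟩)
    · exact key a ha
    · rw [sub_sub_cancel]
      exact (key a ha).symm
  · rintro ⟨h1, h2⟩
    rcases le_or_gt (s : ℤ) x with hx | hx
    · obtain ⟨a, ha, h | h⟩ := key' x hx h1 h2
      · exact Or.inl ⟨a, ha, h⟩
      · exact Or.inr ⟨a, ha, h⟩
    · obtain ⟨a, ha, h | h⟩ := key' (((s + s : ℕ) : ℤ) - 1 - x) (by push_cast; omega) h2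
        (by rwa [sub_sub_cancel])
      · exact Or.inr ⟨a, ha, by omega⟩
      · exact Or.inl ⟨a, ha, by omega⟩

lemma HasArms.Nhook_eq {n t : ℕ} (ht : 0 < t) (hte : Even t) {P : n.Partition} {D : Finset ℕ}
    (h : HasArms P D) : Nhook t P = 2 * (D.filter fun a => ¬ NoHook t D a).card := by
  have hanti := colLen_antitone P
  have hinj : ∀ i k : ℕ, (colLen P (i + 1) : ℤ) - (i + 1 : ℕ) = colLen P (k + 1) - (k + 1 : ℕ) →
      i = k := fun i k hik => by
    rcases le_total i k with hle | hle
    · have := hanti (Nat.succ_le_succ hle)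
      simp only [Nat.succ_eq_add_one] at this
      omega
    · have := hanti (Nat.succ_le_succ hle)
      simp only [Nat.succ_eq_add_one] at this
      omega
  rw [← card_movable hte, Nhook]
  refine Finset.card_nbij (fun c => (rowLen P c.1 : ℤ) - c.1) ?_ ?_ ?_
  · rintro ⟨j, k⟩ hc
    simp only [Finset.mem_coe, Finset.mem_filter, Finset.mem_product, Finset.mem_Icc] at hc
    simp only [hookNum] at hc
    obtain ⟨⟨⟨hj, -⟩, hk, -⟩, -, hook⟩ := hc
    obtain ⟨i, rfl⟩ := Nat.exists_eq_add_of_le' hj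
    obtain ⟨m, rfl⟩ := Nat.exists_eq_add_of_le' hk
    rw [h.rowLen_eq] at hook
    simp only [Finset.mem_coe, mem_movable hte]
    rw [h.rowLen_eq, ← h.exists_colLen_sub_iff,
      ← h.exists_colLen_sub_iff]
    exact ⟨⟨i, by push_cast; ring⟩, m, by push_cast at hook ⊢; linarith⟩
  · rintro ⟨j, k⟩ hc ⟨j', k'⟩ hc' heq
    simp only [Finset.mem_coe, Finset.mem_filter, Finset.mem_product, Finset.mem_Icc] at hc hc' heq
    simp only [hookNum] at hc hc'
    obtain ⟨⟨⟨hj, -⟩, hk, -⟩, -, hook⟩ := hc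
    obtain ⟨⟨⟨hj', -⟩, hk', -⟩, -, hook'⟩ := hc'
    obtain ⟨i, rfl⟩ := Nat.exists_eq_add_of_le' hj
    obtain ⟨m, rfl⟩ := Nat.exists_eq_add_of_le' hk
    obtain ⟨i', rfl⟩ := Nat.exists_eq_add_of_le' hj'
    obtain ⟨m', rfl⟩ := Nat.exists_eq_add_of_le' hk'
    rw [h.rowLen_eq] at hook hook'
    rw [h.rowLen_eq, h.rowLen_eq] at heq
    have hi := hinj i i' heq
    have hm := hinj m m' (by linarith)
    rw [hi, hm]
  · intro x hx
    rw [Finset.mem_coe, mem_movable hte, ← h.exists_colLen_sub_iff, ← h.exists_colLen_sub_iff] at hx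
    obtain ⟨⟨i, hi⟩, m, hm⟩ := hx
    have hsymm : m < colLen P (i + 1) ↔ i < colLen P (m + 1) := by
      rw [h.lt_colLen_iff, h]
    have him : m < colLen P (i + 1) := by
      by_contra hcon
      have := hsymm.not.mp hcon
      omega
    have hi' := le_of_colLen_pos P (Nat.zero_lt_of_lt him)
    have hm' := le_of_colLen_pos P (Nat.zero_lt_of_lt (hsymm.mp him))
    refine ⟨(i + 1, m + 1), ?_, ?_⟩
    · simp only [Finset.mem_coe, Finset.mem_filter, Finset.mem_product, Finset.mem_Icc]
      simp only [hookNum, h.rowLen_eq]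
      exact ⟨⟨⟨by omega, hi'⟩, by omega, hm'⟩, him, by push_cast; omega⟩
    · simp only [h.rowLen_eq]
      push_cast
      exact hi

lemma HasArms.armWeight_eq {n t : ℕ} (ht : 0 < t) (hte : Even t) {P : n.Partition} {D : Finset ℕ}
    (h : HasArms P D) (q T : ℂ) : armWeight t q (T ^ 2) D = T ^ Nhook t P * q ^ n := by
  rw [armWeight, Finset.prod_mul_distrib, Finset.prod_pow_eq_pow_sum, ← h.sum_eq, Finset.prod_ite,
    Finset.prod_const_one, one_mul, Finset.prod_const, ← pow_mul, ← h.Nhook_eq ht hte, mul_comm]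

/-- Self-conjugate partitions correspond to the sets of their diagonal arm lengths. -/
noncomputable def armEquiv : (Σ n, SC n) ≃ Finset ℕ :=
  Equiv.ofBijective (fun x => (Finset.mem_filter.mp x.2.2).2.exists_hasArms.choose) (by
    constructor
    · rintro ⟨n, P, hP⟩ ⟨n', P', hP'⟩ heq
      have h := (Finset.mem_filter.mp hP).2.exists_hasArms.choose_spec
      have h' := (Finset.mem_filter.mp hP').2.exists_hasArms.choose_spec
      simp only at heq
      rw [heq] at h
      obtain rfl : n = n' := h.sum_eq.trans h'.sum_eq.symm
      obtain rfl := h.partition_unique h'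
      rfl
    · intro D
      obtain ⟨P, hP⟩ := exists_hasArms D
      refine ⟨⟨_, P, Finset.mem_filter.mpr ⟨Finset.mem_univ _, hP.isSelfConjugate⟩⟩, ?_⟩
      exact (hP.isSelfConjugate.exists_hasArms.choose_spec).arms_unique hP)

lemma hasArms_armEquiv (x : Σ n, SC n) : HasArms (x.2 : x.1.Partition) (armEquiv x) :=
  (Finset.mem_filter.mp x.2.2).2.exists_hasArms.choose_spec

/-- Generating function for `sc_t(n;T)` when `t` is even:
`Σ_{n≥0} sc_t(n;T) qⁿ = (-q;q²)_∞ · ((1-T²)q^{2t}; q^{2t})_∞^{t/2}`. -/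
theorem stmt2 (t : ℕ) (ht : 2 ≤ t) (hte : Even t) (T : ℂ) (q : ℂ) (hq : ‖q‖ < 1) :
    Summable (fun n : ℕ => ‖(∑ P ∈ SC n, T ^ Nhook t P) * q ^ n‖) ∧
    ∑' n : ℕ, (∑ P ∈ SC n, T ^ Nhook t P) * q ^ n =
      (∏' m : ℕ, (1 + q ^ (2*m+1))) *
        ∏' m : ℕ, (1 - (1 - T^2) * q ^ (2*t*(m+1))) ^ (t/2) := by
  have hw : ∀ x : Σ n, SC n, armWeight t q (T ^ 2) (armEquiv x) =
      T ^ Nhook t (x.2 : x.1.Partition) * q ^ x.1 :=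
    fun x => (hasArms_armEquiv x).armWeight_eq (by omega) hte q T
  have hsum : Summable fun x : Σ n, SC n => ‖T ^ Nhook t (x.2 : x.1.Partition) * q ^ x.1‖ := by
    have h := (armEquiv.summable_iff (f := fun D => ‖armWeight t q (T ^ 2) D‖)).mpr
      (summable_norm_armWeight t hq (T ^ 2))
    exact h.congr fun x => by rw [Function.comp_apply, hw]
  have hfib : ∀ n, ∑' P : SC n, T ^ Nhook t (P : n.Partition) * q ^ n =
      (∑ P ∈ SC n, T ^ Nhook t P) * q ^ n := fun n => by
    rw [tsum_fintype, Finset.sum_coe_sort (SC n) fun P => T ^ Nhook t P * q ^ n, Finset.sum_mul]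
  constructor
  · refine hsum.sigma.of_nonneg_of_le (fun _ => norm_nonneg _) fun n => ?_
    rw [tsum_fintype, ← hfib, tsum_fintype]
    exact norm_sum_le _ _
  · simp only [← hfib]
    rw [← hsum.of_norm.tsum_sigma]
    simp only [← hw]
    rw [armEquiv.tsum_eq (armWeight t q (T ^ 2))]
    obtain ⟨s, rfl⟩ := hte
    have h := tsum_armWeight (s := s) (by omega) hq (1 - T ^ 2)
    rw [sub_sub_cancel] at h
    rw [← two_mul, h, Nat.mul_div_cancel_left s two_pos]
end

section
/- Let t ≥ 1 be an odd integer. Then for every real T > 0 and every q ∈ ℂ with |q| < 1, Σ_{n≥0} sc_t(n;T) q^n = ∏_{m≥0} (1 + q^{2m+1}) · H*(T;q^t) · ∏_{m≥1} (1 − (1 − T²) q^{2tm})^{(t−1)/2}, where the series on the left converges absolutely. -/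
open scoped Real Classical
open Complex Filter Asymptotics

/-- The coefficient `p^(n(n-1)/2) (wp;p)_n / (p;p)_n`, as a product over `k < n`. -/
noncomputable def eulerCoeff (p w : ℂ) (n : ℕ) : ℂ :=
  ∏ k ∈ Finset.range n, (p ^ k * ((1 - w * p ^ (k + 1)) / (1 - p ^ (k + 1))))

/-- The series `∑ p^(n(n-1)/2) (wp;p)_n / (p;p)_n zⁿ`. -/
noncomputable def eulerSeries (p w z : ℂ) : ℂ := ∑' n, eulerCoeff p w n * z ^ n

lemma one_sub_pow_ne_zero_s3 {p : ℂ} (hp : ‖p‖ < 1) (k : ℕ) : 1 - p ^ (k + 1) ≠ 0 := by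
  intro h
  have h1 : ‖p ^ (k + 1)‖ = 1 := by rw [← sub_eq_zero.mp h]; simp
  rw [norm_pow] at h1
  exact (pow_lt_one₀ (norm_nonneg p) hp (Nat.succ_ne_zero k)).ne h1

lemma eulerCoeff_succ {p : ℂ} (w : ℂ) (n : ℕ) :
    eulerCoeff p w (n + 1) =
      eulerCoeff p w n * (p ^ n * ((1 - w * p ^ (n + 1)) / (1 - p ^ (n + 1)))) :=
  Finset.prod_range_succ _ _

lemma eulerCoeff_succ_shift {p : ℂ} (hp : ‖p‖ < 1) (w : ℂ) (n : ℕ) :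
    eulerCoeff p w (n + 1) =
      eulerCoeff p (w * p) n * (p ^ n * ((1 - w * p) / (1 - p ^ (n + 1)))) := by
  induction n with
  | zero => simp [eulerCoeff]
  | succ n ih =>
    rw [eulerCoeff_succ, ih, eulerCoeff_succ (w * p) n]
    have h1 := one_sub_pow_ne_zero_s3 hp n
    have h2 := one_sub_pow_ne_zero_s3 hp (n + 1)
    field_simp
    ring

lemma norm_eulerCoeff_le {p w : ℂ} (hp : ‖p‖ < 1) {W : ℝ} (hw : ‖w‖ ≤ W) (n : ℕ) :
    ‖eulerCoeff p w n‖ ≤ ∏ k ∈ Finset.range n, (‖p‖ ^ k * ((1 + W) / (1 - ‖p‖))) := by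
  rw [eulerCoeff, norm_prod]
  refine Finset.prod_le_prod (fun _ _ => norm_nonneg _) fun k _ => ?_
  have hp' : ‖p‖ ^ (k + 1) ≤ ‖p‖ := pow_le_of_le_one (norm_nonneg p) hp.le (Nat.succ_ne_zero k)
  have hW : 0 ≤ W := (norm_nonneg w).trans hw
  have h1 : ‖1 - w * p ^ (k + 1)‖ ≤ 1 + W := by
    refine (norm_sub_le _ _).trans ?_
    rw [norm_one, norm_mul, norm_pow]
    have : ‖w‖ * ‖p‖ ^ (k + 1) ≤ W * 1 :=
      mul_le_mul hw (hp'.trans hp.le) (by positivity) hW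
    linarith
  have h2 : 1 - ‖p‖ ≤ ‖1 - p ^ (k + 1)‖ := by
    have := norm_sub_norm_le (1 : ℂ) (p ^ (k + 1))
    rw [norm_one, norm_pow] at this
    linarith
  rw [norm_mul, norm_pow, norm_div]
  have h3 : 0 < 1 - ‖p‖ := by linarith
  gcongr

lemma summable_eulerBound {r : ℝ} (hr0 : 0 ≤ r) (hr : r < 1) (D : ℝ) :
    Summable fun n : ℕ => ∏ k ∈ Finset.range n, (r ^ k * D) := by
  refine summable_of_ratio_norm_eventually_le (r := 1 / 2) (by norm_num) ?_
  have h : Tendsto (fun n : ℕ => ‖r ^ n * D‖) atTop (nhds 0) := by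
    have := ((tendsto_pow_atTop_nhds_zero_of_lt_one hr0 hr).mul_const D).norm
    simpa using this
  filter_upwards [h.eventually_le_const (show (0 : ℝ) < 1 / 2 by norm_num)] with n hn
  rw [Finset.prod_range_succ, norm_mul, mul_comm]
  gcongr

lemma norm_eulerTerm_le {p w z : ℂ} (hp : ‖p‖ < 1) {W Z : ℝ} (hw : ‖w‖ ≤ W) (hz : ‖z‖ ≤ Z)
    (n : ℕ) : ‖eulerCoeff p w n * z ^ n‖ ≤
      ∏ k ∈ Finset.range n, (‖p‖ ^ k * ((1 + W) / (1 - ‖p‖) * Z)) := by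
  have h : ∏ k ∈ Finset.range n, (‖p‖ ^ k * ((1 + W) / (1 - ‖p‖) * Z)) =
      (∏ k ∈ Finset.range n, (‖p‖ ^ k * ((1 + W) / (1 - ‖p‖)))) * Z ^ n := by
    simp_rw [← mul_assoc]
    rw [Finset.prod_mul_distrib, Finset.prod_const, Finset.card_range]
  rw [h, norm_mul, norm_pow]
  have := norm_eulerCoeff_le hp hw n
  have h0 := (norm_nonneg _).trans this
  gcongr

lemma summable_eulerTerm {p : ℂ} (hp : ‖p‖ < 1) (w z : ℂ) :
    Summable fun n => eulerCoeff p w n * z ^ n :=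
  Summable.of_norm_bounded (summable_eulerBound (norm_nonneg p) hp _)
    (norm_eulerTerm_le hp le_rfl le_rfl)

lemma tendsto_eulerSeries {p w z : ℂ} (hp : ‖p‖ < 1) {W Z : ℝ} {u v : ℕ → ℂ}
    (huW : ∀ m, ‖u m‖ ≤ W) (hvZ : ∀ m, ‖v m‖ ≤ Z)
    (hu : Tendsto u atTop (nhds w)) (hv : Tendsto v atTop (nhds z)) :
    Tendsto (fun m => eulerSeries p (u m) (v m)) atTop (nhds (eulerSeries p w z)) := by
  refine tendsto_tsum_of_dominated_convergence
    (summable_eulerBound (norm_nonneg p) hp ((1 + W) / (1 - ‖p‖) * Z)) (fun n => ?_)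
    (Eventually.of_forall fun m n => norm_eulerTerm_le hp (huW m) (hvZ m) n)
  refine Tendsto.mul ?_ (hv.pow n)
  refine tendsto_finsetProd _ fun k _ => ?_
  exact ((((hu.mul_const _).const_sub 1).div_const _).const_mul _)

lemma tendsto_mul_pow_zero {p : ℂ} (hp : ‖p‖ < 1) (z : ℂ) :
    Tendsto (fun m : ℕ => z * p ^ m) atTop (nhds 0) := by
  simpa using (tendsto_pow_atTop_nhds_zero_of_norm_lt_one hp).const_mul z

lemma norm_mul_pow_le {p : ℂ} (hp : ‖p‖ < 1) (z : ℂ) (m : ℕ) : ‖z * p ^ m‖ ≤ ‖z‖ := by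
  rw [norm_mul, norm_pow]
  exact mul_le_of_le_one_right (norm_nonneg z) (pow_le_one₀ (norm_nonneg p) hp.le)

lemma eulerSeries_zero (p w : ℂ) : eulerSeries p w 0 = 1 := by
  rw [eulerSeries, tsum_eq_single 0]
  · simp [eulerCoeff]
  · intro n hn
    simp [hn]

lemma eulerSeries_contiguous {p : ℂ} (hp : ‖p‖ < 1) (w z : ℂ) :
    eulerSeries p w z = eulerSeries p (w * p) z - w * p * z * eulerSeries p (w * p) (z * p) := by
  have h1 := summable_eulerTerm hp w z
  have h2 := summable_eulerTerm hp (w * p) z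
  have h3 := summable_eulerTerm hp (w * p) (z * p)
  rw [eulerSeries, eulerSeries, eulerSeries, h1.tsum_eq_zero_add, h2.tsum_eq_zero_add,
    ← tsum_mul_left, add_sub_assoc,
    ← Summable.tsum_sub ((summable_nat_add_iff 1).2 h2) (h3.mul_left _)]
  congr 1
  refine tsum_congr fun n => ?_
  rw [eulerCoeff_succ_shift hp, eulerCoeff_succ]
  have := one_sub_pow_ne_zero_s3 hp n
  field_simp
  ring

lemma eulerSeries_contiguous_shift {p : ℂ} (hp : ‖p‖ < 1) (w z : ℂ) :
    eulerSeries p w (z * p) = eulerSeries p (w * p) z - z * eulerSeries p (w * p) (z * p) := by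
  have h1 := summable_eulerTerm hp w (z * p)
  have h2 := summable_eulerTerm hp (w * p) z
  have h3 := summable_eulerTerm hp (w * p) (z * p)
  rw [eulerSeries, eulerSeries, eulerSeries, h1.tsum_eq_zero_add, h2.tsum_eq_zero_add,
    ← tsum_mul_left, add_sub_assoc,
    ← Summable.tsum_sub ((summable_nat_add_iff 1).2 h2) (h3.mul_left _)]
  congr 1
  refine tsum_congr fun n => ?_
  rw [eulerCoeff_succ_shift hp, eulerCoeff_succ]
  have := one_sub_pow_ne_zero_s3 hp n
  field_simp
  ring

lemma eulerSeries_sub_shift {p : ℂ} (hp : ‖p‖ < 1) (w z : ℂ) :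
    eulerSeries p w z =
      eulerSeries p w (z * p) + z * (1 - w * p) * eulerSeries p (w * p) (z * p) := by
  rw [eulerSeries_contiguous hp w z, eulerSeries_contiguous_shift hp w z]
  ring

/-- The second-order `p`-difference equation in `z`. -/
lemma eulerSeries_shift_rec {p : ℂ} (hp : ‖p‖ < 1) (w z : ℂ) :
    eulerSeries p w z =
      (1 + z) * eulerSeries p w (z * p) - w * p * z * eulerSeries p w (z * p * p) := by
  rw [eulerSeries_sub_shift hp w z, eulerSeries_contiguous_shift hp w (z * p),
    eulerSeries_contiguous hp w (z * p)]
  ring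

lemma multipliable_one_add_mul_pow {q : ℂ} (hq : ‖q‖ < 1) (a : ℂ) :
    Multipliable fun k : ℕ => 1 + a * q ^ k :=
  multipliable_one_add_of_summable <| by
    simpa [norm_mul, norm_pow] using
      (summable_geometric_of_lt_one (norm_nonneg q) hq).mul_left ‖a‖

lemma tendsto_prod_one_add_mul_pow {q : ℂ} (hq : ‖q‖ < 1) (a : ℂ) :
    Tendsto (fun n => ∏ k ∈ Finset.range n, (1 + a * q ^ k)) atTop
      (nhds (∏' k : ℕ, (1 + a * q ^ k))) :=
  (multipliable_one_add_mul_pow hq a).hasProd.tendsto_prod_nat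

/-- A solution of `F a = (1 + a) F (a q)` that is continuous at `0` along `a qⁿ` is a multiple of
the infinite product. -/
lemma eq_tprod_of_functional_eq {q : ℂ} (hq : ‖q‖ < 1) {F : ℂ → ℂ} {s a : ℂ}
    (hF : ∀ a, F a = (1 + s * a) * F (a * q))
    (h0 : Tendsto (fun n : ℕ => F (a * q ^ n)) atTop (nhds (F 0))) :
    F a = (∏' k : ℕ, (1 + s * a * q ^ k)) * F 0 := by
  have h : ∀ n : ℕ, F a = (∏ k ∈ Finset.range n, (1 + s * a * q ^ k)) * F (a * q ^ n) := by
    intro n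
    induction n with
    | zero => simp
    | succ n ih =>
      rw [ih, hF (a * q ^ n), Finset.prod_range_succ]
      ring_nf
  refine tendsto_nhds_unique (tendsto_const_nhds (x := F a) (f := atTop (α := ℕ))) ?_
  exact ((tendsto_prod_one_add_mul_pow hq (s * a)).mul h0).congr fun n => (h n).symm

/-- Euler's product `∑ p^(n(n-1)/2) zⁿ / (p;p)_n = (-z;p)_∞`. -/
lemma eulerSeries_eq_tprod {p : ℂ} (hp : ‖p‖ < 1) (z : ℂ) :
    eulerSeries p 0 z = ∏' k : ℕ, (1 + z * p ^ k) := by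
  have h := eq_tprod_of_functional_eq hp (F := eulerSeries p 0) (s := 1) (a := z)
    (fun a => by rw [eulerSeries_shift_rec hp 0 a]; ring)
    (tendsto_eulerSeries hp (W := 0) (by simp) (norm_mul_pow_le hp z) tendsto_const_nhds
      (tendsto_mul_pow_zero hp z))
  simpa [eulerSeries_zero] using h

/-- The bilinear combination of two series with `z y = p` that generates the partitions of
arbitrary charge. -/
lemma eulerSeries_bilinear {p z y : ℂ} (hp : ‖p‖ < 1) (hzy : z * y = p) (w : ℂ) :
    eulerSeries p w z * eulerSeries p w y -
        p * w * (eulerSeries p w (z * p) * eulerSeries p w (y * p)) =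
      (∏' k : ℕ, (1 - w * p ^ (k + 1))) * (eulerSeries p 0 z * eulerSeries p 0 y) := by
  have hw := norm_mul_pow_le hp w
  have hw0 := tendsto_mul_pow_zero hp w
  have T : ∀ x, Tendsto (fun m : ℕ => eulerSeries p (w * p ^ m) x) atTop
      (nhds (eulerSeries p 0 x)) := fun x =>
    tendsto_eulerSeries hp hw (fun _ => le_rfl) hw0 tendsto_const_nhds
  have h := eq_tprod_of_functional_eq hp (s := -p) (a := w)
    (F := fun w => eulerSeries p w z * eulerSeries p w y -
        p * w * (eulerSeries p w (z * p) * eulerSeries p w (y * p)))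
    (fun w => by
      simp only [eulerSeries_contiguous hp w z, eulerSeries_contiguous hp w y,
        eulerSeries_contiguous_shift hp w z, eulerSeries_contiguous_shift hp w y]
      linear_combination (w ^ 2 * p ^ 2 - p * w) *
        eulerSeries p (w * p) (z * p) * eulerSeries p (w * p) (y * p) * hzy)
    (((T z).mul (T y)).sub ((hw0.const_mul p).mul ((T (z * p)).mul (T (y * p)))))
  simp only [mul_zero, zero_mul, sub_zero] at h
  rw [h]
  congr 1
  exact tprod_congr fun k => by ring

/-- Evaluation of the series at `z ^ 2 = p` through products to the base `-z`. -/
lemma eulerSeries_half {p z : ℂ} (hz : ‖z‖ < 1) (hzp : z * z = p) (a : ℂ) :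
    (1 - a) * (eulerSeries p (a ^ 2) z - z * eulerSeries p (a ^ 2) (z * p)) +
        z * (1 - a ^ 2) * eulerSeries p (a ^ 2) (z * p) =
      (∏' k : ℕ, (1 - a * (-z) ^ k)) * eulerSeries p 0 z := by
  have hp : ‖p‖ < 1 := by
    rw [← hzp, norm_mul]; exact mul_lt_one_of_nonneg_of_lt_one_left (norm_nonneg z) hz hz.le
  have hz' : ‖-z‖ < 1 := by rwa [norm_neg]
  have ha0 := tendsto_mul_pow_zero hz' a
  have T : ∀ x, Tendsto (fun m : ℕ => eulerSeries p ((a * (-z) ^ m) ^ 2) x) atTop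
      (nhds (eulerSeries p (0 ^ 2) x)) := fun x =>
    tendsto_eulerSeries hp (W := ‖a‖ ^ 2)
      (fun m => by rw [norm_pow]; have := norm_mul_pow_le hz' a m; gcongr)
      (fun _ => le_rfl) (ha0.pow 2) tendsto_const_nhds
  have h := eq_tprod_of_functional_eq hz' (s := -1) (a := a)
    (F := fun a => (1 - a) * (eulerSeries p (a ^ 2) z - z * eulerSeries p (a ^ 2) (z * p)) +
        z * (1 - a ^ 2) * eulerSeries p (a ^ 2) (z * p))
    (fun a => by
      have e : (a * -z) ^ 2 = a ^ 2 * p := by rw [← hzp]; ring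
      simp only [e]
      rw [eulerSeries_sub_shift hp (a ^ 2) z, eulerSeries_contiguous_shift hp (a ^ 2) z]
      subst hzp
      ring)
    (((ha0.const_sub 1).mul ((T z).sub ((T (z * p)).const_mul z))).add
      ((((ha0.pow 2).const_sub 1).const_mul z).mul (T (z * p))))
  simp only [neg_mul, one_mul, ← sub_eq_add_neg] at h
  rw [h]
  congr 1
  ring_nf

/-- The weight of the bead positions `A` on one runner: the bead at `k` contributes `z p^k`, and
`x` if `k ≥ 1` and `k - 1` is free; the bead at `0` contributes an additional `c`. -/
noncomputable def runnerWeight (p z c x : ℂ) (A : Finset ℕ) : ℂ :=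
  ∏ k ∈ A, (z * p ^ k * if k = 0 then c else if k - 1 ∈ A then 1 else x)

lemma runnerWeight_insert (p z c x : ℂ) {m : ℕ} {A : Finset ℕ}
    (hA : A ⊆ Finset.range (m + 1)) :
    runnerWeight p z c x (insert (m + 1) A) =
      runnerWeight p z c x A * (z * p ^ (m + 1) * if m ∈ A then 1 else x) := by
  have hlt : ∀ k ∈ A, k < m + 1 := fun k hk => Finset.mem_range.1 (hA hk)
  have hm : m + 1 ∉ A := fun h => (hlt _ h).false
  rw [runnerWeight, Finset.prod_insert hm, mul_comm]
  congr 1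
  · refine Finset.prod_congr rfl fun k hk => ?_
    have : k - 1 ≠ m + 1 := by have := hlt k hk; omega
    simp [this]
  · simp

lemma runnerWeight_eq (p z c x : ℂ) (A : Finset ℕ) :
    runnerWeight p z c x A =
      if 0 ∈ A then c * runnerWeight p z 1 x A else runnerWeight p z 1 x A := by
  split_ifs with h
  · rw [runnerWeight, runnerWeight, ← Finset.mul_prod_erase A _ h,
      ← Finset.mul_prod_erase A (fun k => z * p ^ k * if k = 0 then (1 : ℂ) else _) h]
    have : ∏ k ∈ A.erase 0, (z * p ^ k * if k = 0 then c else if k - 1 ∈ A then 1 else x) =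
        ∏ k ∈ A.erase 0, (z * p ^ k * if k = 0 then 1 else if k - 1 ∈ A then 1 else x) :=
      Finset.prod_congr rfl fun k hk => by simp [Finset.ne_of_mem_erase hk]
    rw [this]
    simp only [if_true]
    ring
  · refine Finset.prod_congr rfl fun k hk => ?_
    have : k ≠ 0 := fun h0 => h (h0 ▸ hk)
    simp [this]

lemma norm_runnerWeight_le (p z c x : ℂ) (A : Finset ℕ) :
    ‖runnerWeight p z c x A‖ ≤ ∏ k ∈ A, (‖z‖ * (1 + ‖c‖ + ‖x‖)) * ‖p‖ ^ k := by
  rw [runnerWeight, norm_prod]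
  refine Finset.prod_le_prod (fun _ _ => norm_nonneg _) fun k _ => ?_
  have h : ‖(if k = 0 then c else if k - 1 ∈ A then 1 else x)‖ ≤ 1 + ‖c‖ + ‖x‖ := by
    have h1 := norm_nonneg c
    have h2 := norm_nonneg x
    split_ifs
    · linarith
    · rw [norm_one]; linarith
    · linarith
  rw [norm_mul, norm_mul, norm_pow, mul_right_comm]
  gcongr

/-- The partial sums of the generating function of one runner. -/
noncomputable def runnerSum (p z c x : ℂ) (m : ℕ) : ℂ :=
  ∑ A ∈ (Finset.range m).powerset, runnerWeight p z c x A

lemma sum_runnerWeight_mul_eulerSeries {p : ℂ} (hp : ‖p‖ < 1) (z c w : ℂ) (m : ℕ) :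
    ∑ A ∈ (Finset.range (m + 1)).powerset, runnerWeight p z c (1 - w) A *
        (eulerSeries p w (z * p ^ (m + 1)) -
          if m ∈ A then 0 else
            w * (z * p ^ (m + 1)) * eulerSeries p w (z * p ^ (m + 1) * p)) =
      eulerSeries p w z + (c - 1) * z * eulerSeries p w (z * p) := by
  induction m with
  | zero =>
    have h : (Finset.range 1).powerset = {∅, {0}} := rfl
    rw [zero_add, h, Finset.sum_pair (Finset.singleton_ne_empty 0).symm]
    rw [eulerSeries_shift_rec hp w z]
    simp [runnerWeight]
    ring
  | succ m ih =>
    rw [Finset.range_add_one, Finset.sum_powerset_insert Finset.notMem_range_self, ← ih,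
      ← Finset.sum_add_distrib]
    refine Finset.sum_congr rfl fun A hA => ?_
    have hA' := Finset.mem_powerset.1 hA
    have hm : m + 1 ∉ A := fun h => by simpa using hA' h
    have e : z * p ^ (m + 1 + 1) = z * p ^ (m + 1) * p := by ring
    rw [runnerWeight_insert p z c _ hA', e, eulerSeries_shift_rec hp w (z * p ^ (m + 1))]
    simp only [hm, Finset.mem_insert_self, if_true, if_false]
    split_ifs <;> ring

lemma summable_finset_prod_geometric {r : ℝ} (hr0 : 0 ≤ r) (hr : r < 1) {C : ℝ} (hC : 0 ≤ C) :
    Summable fun A : Finset ℕ => ∏ k ∈ A, C * r ^ k :=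
  summable_finsetProd_of_summable_nonneg (fun _ => by positivity)
    ((summable_geometric_of_lt_one hr0 hr).mul_left C)

lemma tendsto_runnerSum {p : ℂ} (hp : ‖p‖ < 1) (z c w : ℂ) :
    Tendsto (runnerSum p z c (1 - w)) atTop
      (nhds (eulerSeries p w z + (c - 1) * z * eulerSeries p w (z * p))) := by
  rw [← tendsto_add_atTop_iff_nat 1]
  set C := ‖z‖ * (1 + ‖c‖ + ‖1 - w‖)
  have hC : 0 ≤ C := by positivity
  have hs := summable_finset_prod_geometric (norm_nonneg p) hp hC
  set B := ∑' A : Finset ℕ, ∏ k ∈ A, C * ‖p‖ ^ k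
  have hz : Tendsto (fun m : ℕ => z * p ^ (m + 1)) atTop (nhds 0) :=
    (tendsto_add_atTop_iff_nat 1).2 (tendsto_mul_pow_zero hp z)
  have hf : Tendsto (fun m : ℕ => eulerSeries p w (z * p ^ (m + 1))) atTop (nhds 1) := by
    rw [← eulerSeries_zero p w]
    exact tendsto_eulerSeries hp (W := ‖w‖) (fun _ => le_rfl)
      (fun m => norm_mul_pow_le hp z (m + 1)) tendsto_const_nhds hz
  have hf' : Tendsto (fun m : ℕ => eulerSeries p w (z * p ^ (m + 1) * p)) atTop (nhds 1) :=
    ((tendsto_add_atTop_iff_nat 1).2 hf).congr fun m => by ring_nf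
  have hε : Tendsto (fun m : ℕ => B * (‖1 - eulerSeries p w (z * p ^ (m + 1))‖ +
      ‖w * (z * p ^ (m + 1)) * eulerSeries p w (z * p ^ (m + 1) * p)‖)) atTop (nhds 0) := by
    have := (((hf.const_sub 1).norm).add (((hz.const_mul w).mul hf').norm)).const_mul B
    simpa using this
  rw [tendsto_iff_norm_sub_tendsto_zero]
  refine squeeze_zero (fun _ => norm_nonneg _) (fun m => ?_) hε
  rw [runnerSum, ← sum_runnerWeight_mul_eulerSeries hp z c w m, ← Finset.sum_sub_distrib]
  refine (norm_sum_le _ _).trans ?_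
  calc _ ≤ ∑ A ∈ (Finset.range (m + 1)).powerset, (∏ k ∈ A, C * ‖p‖ ^ k) *
        (‖1 - eulerSeries p w (z * p ^ (m + 1))‖ +
          ‖w * (z * p ^ (m + 1)) * eulerSeries p w (z * p ^ (m + 1) * p)‖) := by
        refine Finset.sum_le_sum fun A _ => ?_
        rw [← mul_one_sub, norm_mul]
        refine mul_le_mul (norm_runnerWeight_le _ _ _ _ _) ?_ (norm_nonneg _)
          (Finset.prod_nonneg fun _ _ => by positivity)
        split_ifs
        · rw [sub_zero]
          exact le_add_of_nonneg_right (norm_nonneg _)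
        · rw [← sub_add]; exact norm_add_le _ _
    _ ≤ _ := by
        rw [← Finset.sum_mul]
        gcongr
        exact hs.sum_le_tsum _ fun A _ => Finset.prod_nonneg fun _ _ => by positivity

/-- The partial sums of the generating function of a pair of conjugate runners. -/
noncomputable def runnerPairSum (p z y T : ℂ) (m : ℕ) : ℂ :=
  ∑ AB ∈ (Finset.range m).powerset ×ˢ (Finset.range m).powerset,
    runnerWeight p z (if 0 ∈ AB.2 then T else 1) (T ^ 2) AB.1 *
      runnerWeight p y (if 0 ∈ AB.1 then T else 1) (T ^ 2) AB.2

lemma runnerPairSum_eq (p z y T : ℂ) (m : ℕ) :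
    runnerPairSum p z y T m =
      runnerSum p z 0 (T ^ 2) m * runnerSum p y 1 (T ^ 2) m +
        (runnerSum p z 1 (T ^ 2) m - runnerSum p z 0 (T ^ 2) m) *
          runnerSum p y (T ^ 2) (T ^ 2) m := by
  simp only [runnerPairSum, runnerSum]
  rw [Finset.sum_product, ← Finset.sum_sub_distrib, Finset.sum_mul_sum, Finset.sum_mul_sum,
    ← Finset.sum_add_distrib]
  refine Finset.sum_congr rfl fun A _ => ?_
  rw [← Finset.sum_add_distrib]
  refine Finset.sum_congr rfl fun B _ => ?_
  simp only
  rw [runnerWeight_eq p z 0, runnerWeight_eq p z (if 0 ∈ B then T else 1),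
    runnerWeight_eq p y (if 0 ∈ A then T else 1), runnerWeight_eq p y (T ^ 2)]
  split_ifs <;> ring

lemma tendsto_runnerPairSum {p z y : ℂ} (hp : ‖p‖ < 1) (hzy : z * y = p) (T : ℂ) :
    Tendsto (runnerPairSum p z y T) atTop
      (nhds ((∏' k : ℕ, (1 - (1 - T ^ 2) * p ^ (k + 1))) *
        (eulerSeries p 0 z * eulerSeries p 0 y))) := by
  rw [← eulerSeries_bilinear hp hzy]
  set w := 1 - T ^ 2 with hw
  have hT : T ^ 2 = 1 - w := by rw [hw]; ring
  have h := ((tendsto_runnerSum hp z 0 w).mul (tendsto_runnerSum hp y 1 w)).add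
    (((tendsto_runnerSum hp z 1 w).sub (tendsto_runnerSum hp z 0 w)).mul
      (tendsto_runnerSum hp y (1 - w) w))
  refine (h.congr fun m => ?_).trans_eq ?_
  · rw [runnerPairSum_eq, hT]
  · congr 1
    linear_combination (-w * eulerSeries p w (z * p) * eulerSeries p w (y * p)) * hzy

/-- The weight `q^(∑ (2i+1)) T^(number of hooks of length t)` of the self-conjugate partition
whose diagonal hooks have lengths `2i+1`, `i ∈ S`. -/
noncomputable def diagonalWeight (t : ℕ) (q T : ℂ) (S : Finset ℕ) : ℂ :=
  ∏ i ∈ S, (q ^ (2 * i + 1) *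
    if i < t then (if t - 1 - i ∈ S then T else 1) else if i - t ∈ S then 1 else T ^ 2)

/-- The positions of the elements of `S` on the runner of residue `r` modulo `t`. -/
def runner (t m : ℕ) (S : Finset ℕ) (r : ℕ) : Finset ℕ :=
  (Finset.range m).filter fun k => t * k + r ∈ S

lemma mem_runner {t m k r : ℕ} {S : Finset ℕ} : k ∈ runner t m S r ↔ k < m ∧ t * k + r ∈ S := by
  simp [runner]

lemma prod_range_mul_eq {M : Type*} [CommMonoid M] (t m : ℕ) (g : ℕ → M) :
    ∏ i ∈ Finset.range (t * m), g i =
      ∏ r ∈ Finset.range t, ∏ k ∈ Finset.range m, g (t * k + r) := by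
  rw [Finset.prod_comm]
  induction m with
  | zero => simp
  | succ m ih => rw [mul_add_one, Finset.prod_range_add, ih, Finset.prod_range_succ]

lemma prod_range_odd_eq {M : Type*} [CommMonoid M] (d : ℕ) (g : ℕ → M) :
    ∏ r ∈ Finset.range (2 * d + 1), g r = g d * ∏ r : Fin d, (g r * g (2 * d - r)) := by
  have h : 2 * d + 1 = d + (1 + d) := by ring
  rw [h, Finset.prod_range_add, Finset.prod_range_add, Finset.prod_range_one,
    ← Finset.prod_range_reflect (fun j => g (d + (1 + j))), mul_left_comm,
    ← Finset.prod_mul_distrib, Finset.prod_range, add_zero]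
  congr 1
  refine Finset.prod_congr rfl fun r _ => ?_
  have := r.2
  have e : d + (1 + (d - 1 - (r : ℕ))) = 2 * d - r := by omega
  rw [e]

lemma diagonalWeight_eq_prod_runner {t m : ℕ} (q T : ℂ) {S : Finset ℕ}
    (hS : S ⊆ Finset.range (t * m)) :
    diagonalWeight t q T S = ∏ r ∈ Finset.range t,
      runnerWeight (q ^ (2 * t)) (q ^ (2 * r + 1))
        (if 0 ∈ runner t m S (t - 1 - r) then T else 1) (T ^ 2) (runner t m S r) := by
  have h : S = (Finset.range (t * m)).filter (· ∈ S) := by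
    ext i
    simpa using fun hi => Finset.mem_range.1 (hS hi)
  rw [diagonalWeight]
  conv_lhs => rw [h]
  rw [Finset.prod_filter, prod_range_mul_eq]
  refine Finset.prod_congr rfl fun r hr => ?_
  rw [runnerWeight, runner, Finset.prod_filter]
  refine Finset.prod_congr rfl fun k hk => ?_
  have hr := Finset.mem_range.1 hr
  have hk := Finset.mem_range.1 hk
  by_cases hi : t * k + r ∈ S
  · have hm : 0 < m := by omega
    rw [if_pos hi, if_pos hi]
    congr 1
    · ring
    · rcases Nat.eq_zero_or_pos k with rfl | hk0
      · simp [hr, mem_runner, hm, ← h]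
      · obtain ⟨k, rfl⟩ : ∃ j, k = j + 1 := ⟨k - 1, by omega⟩
        have h1 : ¬ t * (k + 1) + r < t := by rw [mul_add_one]; omega
        have h2 : t * (k + 1) + r - t = t * k + r := by rw [mul_add_one]; omega
        have h3 : k < m := by omega
        simp only [← h, h1, h2, if_false, Finset.mem_filter, Finset.mem_range, Nat.add_sub_cancel,
          Nat.succ_ne_zero, h3, true_and]
  · rw [if_neg hi, if_neg hi]

/-- The set with prescribed positions `F r` on the runner of residue `r`. -/
def ofRunners (t m : ℕ) (F : ℕ → Finset ℕ) : Finset ℕ :=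
  (Finset.range (t * m)).filter fun i => i / t ∈ F (i % t)

lemma runner_ofRunners {t m r : ℕ} (hr : r < t) {F : ℕ → Finset ℕ}
    (hF : F r ⊆ Finset.range m) : runner t m (ofRunners t m F) r = F r := by
  ext k
  have h1 : (t * k + r) / t = k := by
    rw [Nat.mul_add_div (by omega), Nat.div_eq_of_lt hr, add_zero]
  have h2 : (t * k + r) % t = r := by rw [Nat.mul_add_mod, Nat.mod_eq_of_lt hr]
  simp only [mem_runner, ofRunners, Finset.mem_filter, Finset.mem_range, h1, h2]
  refine ⟨fun h => h.2.2, fun h => ?_⟩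
  have hk := Finset.mem_range.1 (hF h)
  refine ⟨hk, ?_, h⟩
  calc t * k + r < t * k + t := by omega
    _ = t * (k + 1) := by ring
    _ ≤ t * m := Nat.mul_le_mul_left t hk

lemma ofRunners_eq {t m : ℕ} (ht : 0 < t) {S : Finset ℕ} (hS : S ⊆ Finset.range (t * m))
    {F : ℕ → Finset ℕ} (hF : ∀ r < t, F r = runner t m S r) : ofRunners t m F = S := by
  ext i
  simp only [ofRunners, Finset.mem_filter, hF _ (Nat.mod_lt i ht), mem_runner, Nat.div_add_mod,
    Finset.mem_range]
  refine ⟨fun h => h.2.2, fun h => ?_⟩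
  have hi := Finset.mem_range.1 (hS h)
  exact ⟨hi, Nat.div_lt_of_lt_mul hi, h⟩

/-- The runners determined by the middle one and by the pairs of conjugate ones. -/
def pairedRunners (d : ℕ) (A : Finset ℕ) (B : Fin d → Finset ℕ × Finset ℕ) (r : ℕ) : Finset ℕ :=
  if r = d then A
  else if h : r < d then (B ⟨r, h⟩).1
  else if h : 2 * d - r < d then (B ⟨2 * d - r, h⟩).2 else ∅

lemma sum_diagonalWeight (d m : ℕ) (q T : ℂ) :
    ∑ S ∈ (Finset.range ((2 * d + 1) * m)).powerset, diagonalWeight (2 * d + 1) q T S =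
      runnerSum (q ^ (2 * (2 * d + 1))) (q ^ (2 * d + 1)) T (T ^ 2) m *
        ∏ r : Fin d, runnerPairSum (q ^ (2 * (2 * d + 1))) (q ^ (2 * (r : ℕ) + 1))
          (q ^ (2 * (2 * d - r) + 1)) T m := by
  have ht : 0 < 2 * d + 1 := by omega
  simp only [runnerSum, runnerPairSum]
  rw [Finset.prod_univ_sum, Finset.sum_mul_sum, ← Finset.sum_product']
  have hsub : ∀ S r, runner (2 * d + 1) m S r ⊆ Finset.range m := fun S r =>
    Finset.filter_subset _ _
  refine Finset.sum_nbij'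
    (fun S => (runner (2 * d + 1) m S d,
      fun r : Fin d => (runner (2 * d + 1) m S r, runner (2 * d + 1) m S (2 * d - r))))
    (fun AB => ofRunners (2 * d + 1) m (pairedRunners d AB.1 AB.2)) ?_ ?_ ?_ ?_ ?_
  · intro S _
    simp [hsub]
  · intro AB _
    exact Finset.mem_powerset.2 (Finset.filter_subset _ _)
  · intro S hS
    refine ofRunners_eq ht (Finset.mem_powerset.1 hS) fun r hr => ?_
    rw [pairedRunners]
    split_ifs with h1 h2 h3
    · rw [h1]
    · rfl
    · have : 2 * d - (2 * d - r) = r := by omega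
      simp [this]
    · omega
  · rintro ⟨A, B⟩ hAB
    simp only [Finset.mem_product, Finset.mem_powerset, Fintype.mem_piFinset] at hAB
    obtain ⟨hA, hB⟩ := hAB
    have e1 : pairedRunners d A B d = A := by simp [pairedRunners]
    have e2 : ∀ r : Fin d, pairedRunners d A B r = (B r).1 := fun r => by
      simp [pairedRunners, r.2.ne]
    have e3 : ∀ r : Fin d, pairedRunners d A B (2 * d - r) = (B r).2 := fun r => by
      have := r.2
      have h1 : 2 * d - r ≠ d := by omega
      have h2 : ¬ 2 * d - r < d := by omega
      have h3 : 2 * d - (2 * d - r) = r := by omega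
      simp [pairedRunners, h1, h2, h3]
    ext1
    · exact (runner_ofRunners (by omega) (by rwa [e1])).trans e1
    · funext r
      have := r.2
      ext1
      · exact (runner_ofRunners (by omega) (by rw [e2]; exact (hB r).1)).trans (e2 r)
      · exact (runner_ofRunners (by omega) (by rw [e3]; exact (hB r).2)).trans (e3 r)
  · intro S hS
    rw [diagonalWeight_eq_prod_runner q T (Finset.mem_powerset.1 hS), prod_range_odd_eq]
    have h1 : 2 * d + 1 - 1 - d = d := by omega
    simp only [h1]
    congr 1
    · rw [runnerWeight_eq, runnerWeight_eq _ _ T]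
      split_ifs <;> simp
    · refine Finset.prod_congr rfl fun r _ => ?_
      have := r.2
      have h2 : 2 * d + 1 - 1 - (r : ℕ) = 2 * d - r := by omega
      have h3 : 2 * d + 1 - 1 - (2 * d - (r : ℕ)) = r := by omega
      rw [h2, h3]
lemma le_card_filter_Icc_iff {n : ℕ} {p : ℕ → Prop} [DecidablePred p]
    (hp : ∀ a b, 1 ≤ a → a ≤ b → p b → p a)
    (hn : ∀ k, 1 ≤ k → p k → k ≤ n) {k : ℕ} (hk : 1 ≤ k) :
    k ≤ ((Finset.Icc 1 n).filter p).card ↔ p k := by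
  constructor
  · intro h
    by_contra hpk
    have hsub : (Finset.Icc 1 n).filter p ⊆ Finset.Icc 1 (k - 1) := by
      intro b hb
      rw [Finset.mem_filter, Finset.mem_Icc] at hb
      have : b < k := by
        by_contra hbk
        exact hpk (hp k b hk (not_lt.1 hbk) hb.2)
      rw [Finset.mem_Icc]
      omega
    have := Finset.card_le_card hsub
    rw [Nat.card_Icc] at this
    omega
  · intro h
    have hsub : Finset.Icc 1 k ⊆ (Finset.Icc 1 n).filter p := by
      intro b hb
      rw [Finset.mem_Icc] at hb
      rw [Finset.mem_filter, Finset.mem_Icc]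
      exact ⟨⟨hb.1, hb.2.trans (hn k hk h)⟩, hp b k hb.1 hb.2 h⟩
    simpa using Finset.card_le_card hsub

/-- A sequence of column lengths (indexed from `1`) that equals its conjugate. -/
structure IsSymmProfile (n : ℕ) (c : ℕ → ℕ) : Prop where
  symm : ∀ {j k}, 1 ≤ j → 1 ≤ k → j ≤ c k → k ≤ c j
  le : ∀ {k}, 1 ≤ k → c k ≤ n

/-- The set of `i` such that `2i + 1` is a diagonal hook length. -/
def diagSet (n : ℕ) (c : ℕ → ℕ) : Finset ℕ :=
  ((Finset.Icc 1 n).filter fun j => j ≤ c j).image fun j => c j - j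

namespace IsSymmProfile

variable {n : ℕ} {c : ℕ → ℕ}

lemma anti (h : IsSymmProfile n c) {j k : ℕ} (hj : 1 ≤ j) (hjk : j ≤ k) : c k ≤ c j := by
  rcases Nat.eq_zero_or_pos (c k) with h0 | h0
  · omega
  · exact h.symm hj h0 (hjk.trans (h.symm h0 (hj.trans hjk) le_rfl))

lemma index_unique (h : IsSymmProfile n c) {j k : ℕ} (hj : 1 ≤ j) (hk : 1 ≤ k)
    (e : c j + k = c k + j) : j = k := by
  rcases le_total j k with hjk | hjk
  · have := h.anti hj hjk; omega
  · have := h.anti hk hjk; omega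

lemma mem_diagSet (h : IsSymmProfile n c) {i : ℕ} :
    i ∈ diagSet n c ↔ ∃ j, 1 ≤ j ∧ c j = j + i := by
  simp only [diagSet, Finset.mem_image, Finset.mem_filter, Finset.mem_Icc]
  constructor
  · rintro ⟨j, ⟨⟨hj, -⟩, hjc⟩, rfl⟩
    exact ⟨j, hj, by omega⟩
  · rintro ⟨j, hj, e⟩
    have := h.le hj
    exact ⟨j, ⟨⟨hj, by omega⟩, by omega⟩, by omega⟩

lemma injOn_diag (h : IsSymmProfile n c) :
    Set.InjOn (fun j => c j - j) ((Finset.Icc 1 n).filter fun j => j ≤ c j : Finset ℕ) := by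
  intro j hj k hk e
  simp only [Finset.coe_filter, Finset.mem_Icc, Set.mem_ofPred_eq] at hj hk e
  exact h.index_unique hj.1.1 hk.1.1 (by omega)

lemma sum_eq (h : IsSymmProfile n c) :
    ∑ j ∈ Finset.Icc 1 n, c j = ∑ i ∈ diagSet n c, (2 * i + 1) := by
  have h1 : ∑ j ∈ Finset.Icc 1 n, min (c j) (j - 1) = ∑ j ∈ Finset.Icc 1 n, (c j - j) := by
    have e1 : ∀ j ∈ Finset.Icc 1 n, min (c j) (j - 1) =
        ∑ k ∈ Finset.Icc 1 n, if k < j ∧ k ≤ c j then 1 else 0 := by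
      intro j hj
      rw [Finset.mem_Icc] at hj
      rw [← Finset.card_filter]
      have : (Finset.Icc 1 n).filter (fun k => k < j ∧ k ≤ c j) =
          Finset.Icc 1 (min (c j) (j - 1)) := by
        ext k
        simp only [Finset.mem_filter, Finset.mem_Icc]
        omega
      rw [this, Nat.card_Icc, Nat.add_sub_cancel]
    have e2 : ∀ k ∈ Finset.Icc 1 n, c k - k =
        ∑ j ∈ Finset.Icc 1 n, if k < j ∧ k ≤ c j then 1 else 0 := by
      intro k hk
      rw [Finset.mem_Icc] at hk
      rw [← Finset.card_filter]
      have : (Finset.Icc 1 n).filter (fun j => k < j ∧ k ≤ c j) = Finset.Ioc k (c k) := by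
        ext j
        simp only [Finset.mem_filter, Finset.mem_Icc, Finset.mem_Ioc]
        constructor
        · rintro ⟨hj, hkj, hc⟩
          exact ⟨hkj, h.symm hk.1 hj.1 hc⟩
        · rintro ⟨hkj, hc⟩
          have hj : 1 ≤ j := by omega
          exact ⟨⟨hj, hc.trans (h.le hk.1)⟩, hkj, h.symm hj hk.1 hc⟩
      rw [this, Nat.card_Ioc]
    rw [Finset.sum_congr rfl e1, Finset.sum_congr rfl e2, Finset.sum_comm]
  have h2 : ∀ j ∈ Finset.Icc 1 n, c j =
      min (c j) (j - 1) + ((c j - j) + if j ≤ c j then 1 else 0) := by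
    intro j hj
    rw [Finset.mem_Icc] at hj
    split_ifs <;> omega
  rw [Finset.sum_congr rfl h2, Finset.sum_add_distrib, h1, ← Finset.sum_add_distrib, diagSet,
    Finset.sum_image h.injOn_diag, Finset.sum_filter]
  refine Finset.sum_congr rfl fun j _ => ?_
  split_ifs <;> omega

lemma le_card_diagSet_filter_iff (h : IsSymmProfile n c) {j : ℕ} (hj : 1 ≤ j) (d : ℕ) :
    j ≤ ((diagSet n c).filter (d ≤ ·)).card ↔ j + d ≤ c j := by
  have e : ((diagSet n c).filter (d ≤ ·)).card =
      ((Finset.Icc 1 n).filter fun j => j + d ≤ c j).card := by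
    rw [diagSet, Finset.filter_image, Finset.card_image_of_injOn, Finset.filter_filter]
    · congr 1
      refine Finset.filter_congr fun j _ => ?_
      omega
    · exact h.injOn_diag.mono (Finset.coe_subset.2 (Finset.filter_subset _ _))
  rw [e]
  refine le_card_filter_Icc_iff (n := n) (p := fun j => j + d ≤ c j) (fun a b ha hab hb => ?_)
    (fun k hk hb => ?_) hj
  · have := h.anti ha hab; omega
  · have := h.le hk; omega

lemma eq_of_diagSet_eq {c' : ℕ → ℕ} (h : IsSymmProfile n c) (h' : IsSymmProfile n c')
    (e : diagSet n c = diagSet n c') {j : ℕ} (hj : 1 ≤ j) : c j = c' j := by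
  have key : ∀ {j k}, 1 ≤ j → j ≤ k → (k ≤ c j ↔ k ≤ c' j) := by
    intro j k hj hjk
    have e1 := h.le_card_diagSet_filter_iff hj (k - j)
    rw [e, h'.le_card_diagSet_filter_iff hj, Nat.add_sub_cancel' hjk] at e1
    exact e1.symm
  have all : ∀ k, 1 ≤ k → (k ≤ c j ↔ k ≤ c' j) := by
    intro k hk
    rcases le_total j k with hjk | hjk
    · exact key hj hjk
    · have := key hk hjk
      exact ⟨fun a => h'.symm hj hk (this.1 (h.symm hk hj a)),
        fun a => h.symm hj hk (this.2 (h'.symm hk hj a))⟩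
  refine le_antisymm ?_ ?_
  · rcases Nat.eq_zero_or_pos (c j) with h0 | h0
    · omega
    · exact (all _ h0).1 le_rfl
  · rcases Nat.eq_zero_or_pos (c' j) with h0 | h0
    · omega
    · exact (all _ h0).2 le_rfl

/-- Exactly one of `i` and `-1-i` is of the form `c j - j`. -/
lemma notMem_diagSet_iff (h : IsSymmProfile n c) {i : ℕ} :
    i ∉ diagSet n c ↔ ∃ k, 1 ≤ k ∧ c k + i + 1 = k := by
  constructor
  · intro hi
    set J := ((diagSet n c).filter (i ≤ ·)).card
    have hJ : ∀ {j}, 1 ≤ j → (j ≤ J ↔ j + i ≤ c j) := fun hj => h.le_card_diagSet_filter_iff hj i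
    refine ⟨J + i + 1, by omega, ?_⟩
    have h1 : ¬ J + 1 ≤ c (J + i + 1) := fun hc => by
      have := h.symm (by omega) (by omega) hc
      have := (hJ (j := J + 1) (by omega)).2 (by omega)
      omega
    have h2 : J ≤ c (J + i + 1) := by
      rcases Nat.eq_zero_or_pos J with h0 | h0
      · omega
      · refine h.symm (by omega) h0 ?_
        have h3 := (hJ h0).1 le_rfl
        have h4 : c J ≠ J + i := fun e => hi (h.mem_diagSet.2 ⟨J, h0, e⟩)
        omega
    omega
  · rintro ⟨k, hk, e⟩ hi
    obtain ⟨j, hj, e'⟩ := h.mem_diagSet.1 hi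
    rcases le_or_gt j (c k) with hc | hc
    · have := h.symm hj hk hc; omega
    · have : c j < k := by
        by_contra hc'
        have := h.symm hk hj (not_lt.1 hc')
        omega
      omega

lemma card_hooks (h : IsSymmProfile n c) (t : ℕ) :
    ((Finset.Icc 1 n ×ˢ Finset.Icc 1 n).filter
        fun a => a.2 ≤ c a.1 ∧ c a.1 + c a.2 + 1 = a.1 + a.2 + t).card =
      ∑ i ∈ diagSet n c, if i < t then (if t - 1 - i ∈ diagSet n c then 1 else 0)
        else if i - t ∈ diagSet n c then 0 else 2 := by
  set H := (Finset.Icc 1 n ×ˢ Finset.Icc 1 n).filter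
    fun a => a.2 ≤ c a.1 ∧ c a.1 + c a.2 + 1 = a.1 + a.2 + t with hH
  set S := diagSet n c with hS
  have memH : ∀ a : ℕ × ℕ, a ∈ H ↔ ((1 ≤ a.1 ∧ a.1 ≤ n) ∧ (1 ≤ a.2 ∧ a.2 ≤ n)) ∧
      a.2 ≤ c a.1 ∧ c a.1 + c a.2 + 1 = a.1 + a.2 + t := by
    intro a
    simp [hH]
  have inj : ∀ a ∈ H, ∀ b ∈ H, a.1 ≤ c a.1 → b.1 ≤ c b.1 → c a.1 - a.1 = c b.1 - b.1 →
      a = b := by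
    intro a ha b hb ha1 hb1 e
    rw [memH] at ha hb
    have e1 : a.1 = b.1 := h.index_unique ha.1.1.1 hb.1.1.1 (by omega)
    have e2 : a.2 = b.2 := h.index_unique ha.1.2.1 hb.1.2.1 (by rw [e1] at ha; omega)
    exact Prod.ext e1 e2
  have cell : ∀ {j k}, 1 ≤ j → 1 ≤ k → j + k < c j + c k + 2 → k ≤ c j := by
    intro j k hj hk hlt
    by_contra hc
    have : ¬ j ≤ c k := fun hc' => hc (h.symm hj hk hc')
    omega
  have c1 : (H.filter fun a => a.1 + t ≤ c a.1).card =
      (S.filter fun i => ¬ i < t ∧ i - t ∉ S).card := by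
    refine Finset.card_bij (fun a _ => c a.1 - a.1) ?_ ?_ ?_
    · intro a ha
      rw [Finset.mem_filter, memH] at ha
      rw [Finset.mem_filter, h.mem_diagSet, h.notMem_diagSet_iff]
      exact ⟨⟨a.1, ha.1.1.1.1, by omega⟩, by omega, a.2, ha.1.1.2.1, by omega⟩
    · intro a ha b hb e
      rw [Finset.mem_filter] at ha hb
      exact inj a ha.1 b hb.1 (by omega) (by omega) e
    · intro i hi
      rw [Finset.mem_filter, h.mem_diagSet, h.notMem_diagSet_iff] at hi
      obtain ⟨⟨j, hj, ej⟩, hit, k, hk, ek⟩ := hi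
      have hc := cell hj hk (by omega)
      have h1 := h.le hj
      refine ⟨(j, k), ?_, by simp [ej]⟩
      rw [Finset.mem_filter, memH]
      simp only
      omega
  have c2 : ((H.filter fun a => ¬ a.1 + t ≤ c a.1).filter fun a => a.2 + t ≤ c a.2).card =
      (H.filter fun a => a.1 + t ≤ c a.1).card := by
    refine Finset.card_bij (fun a _ => a.swap) ?_ (fun a _ b _ e => Prod.swap_injective e) ?_
    · intro a ha
      rw [Finset.mem_filter, Finset.mem_filter, memH] at ha
      have := h.symm ha.1.1.1.2.1 ha.1.1.1.1.1 ha.1.1.2.1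
      rw [Finset.mem_filter, memH, Prod.fst_swap, Prod.snd_swap]
      omega
    · intro a ha
      rw [Finset.mem_filter, memH] at ha
      have := h.symm ha.1.1.2.1 ha.1.1.1.1 ha.1.2.1
      refine ⟨a.swap, ?_, Prod.swap_swap a⟩
      rw [Finset.mem_filter, Finset.mem_filter, memH, Prod.fst_swap, Prod.snd_swap]
      omega
  have c3 : ((H.filter fun a => ¬ a.1 + t ≤ c a.1).filter fun a => ¬ a.2 + t ≤ c a.2).card =
      (S.filter fun i => i < t ∧ t - 1 - i ∈ S).card := by
    refine Finset.card_bij (fun a _ => c a.1 - a.1) ?_ ?_ ?_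
    · intro a ha
      rw [Finset.mem_filter, Finset.mem_filter, memH] at ha
      rw [Finset.mem_filter, h.mem_diagSet, h.mem_diagSet]
      exact ⟨⟨a.1, ha.1.1.1.1.1, by omega⟩, by omega, a.2, ha.1.1.1.2.1, by omega⟩
    · intro a ha b hb e
      rw [Finset.mem_filter, Finset.mem_filter] at ha hb
      have ha' := (memH a).1 ha.1.1
      have hb' := (memH b).1 hb.1.1
      exact inj a ha.1.1 b hb.1.1 (by omega) (by omega) e
    · intro i hi
      rw [Finset.mem_filter, h.mem_diagSet, h.mem_diagSet] at hi
      obtain ⟨⟨j, hj, ej⟩, hit, k, hk, ek⟩ := hi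
      have hc := cell hj hk (by omega)
      have h1 := h.le hj
      refine ⟨(j, k), ?_, by simp [ej]⟩
      rw [Finset.mem_filter, Finset.mem_filter, memH]
      simp only
      omega
  rw [← Finset.card_filter_add_card_filter_not (s := H) (fun a => a.1 + t ≤ c a.1),
    ← Finset.card_filter_add_card_filter_not
      (s := H.filter fun a => ¬ a.1 + t ≤ c a.1) (fun a => a.2 + t ≤ c a.2), c2, c3, c1,
    Finset.card_filter, Finset.card_filter, ← Finset.sum_add_distrib, ← Finset.sum_add_distrib]
  refine Finset.sum_congr rfl fun i _ => ?_
  by_cases h1 : i < t <;> by_cases h2 : t - 1 - i ∈ S <;> by_cases h3 : i - t ∈ S <;>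
    simp [h1, h2, h3]

end IsSymmProfile

/-- The column lengths of the self-conjugate diagram whose diagonal hook lengths are `2i + 1`,
`i ∈ S`. -/
def profileOf (n : ℕ) (S : Finset ℕ) (j : ℕ) : ℕ :=
  ((Finset.Icc 1 n).filter fun k => min j k ≤ (S.filter (max j k - min j k ≤ ·)).card).card

lemma card_filter_le_succ (S : Finset ℕ) (d : ℕ) :
    (S.filter (d ≤ ·)).card = (S.filter (d + 1 ≤ ·)).card + if d ∈ S then 1 else 0 := by
  have h : S.filter (d ≤ ·) = S.filter (d + 1 ≤ ·) ∪ S.filter (d = ·) := by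
    rw [← Finset.filter_or]
    refine Finset.filter_congr fun i _ => ?_
    omega
  rw [h, Finset.card_union_of_disjoint, Finset.filter_eq]
  · split_ifs <;> simp
  · rw [Finset.disjoint_filter]
    intro i _ hi
    omega

lemma card_filter_le_add (S : Finset ℕ) (d e : ℕ) :
    (S.filter (d ≤ ·)).card ≤ (S.filter (d + e ≤ ·)).card + e := by
  induction e with
  | zero => simp
  | succ e ih =>
    have := card_filter_le_succ S (d + e)
    change _ ≤ (S.filter (d + e + 1 ≤ ·)).card + (e + 1)
    split_ifs at this <;> omega

lemma card_filter_le_anti (S : Finset ℕ) {d e : ℕ} (h : d ≤ e) :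
    (S.filter (e ≤ ·)).card ≤ (S.filter (d ≤ ·)).card :=
  Finset.card_le_card (Finset.monotone_filter_right _ fun _ _ hi => h.trans hi)

lemma add_le_sum_of_le_card {S : Finset ℕ} {a d : ℕ} (ha : 1 ≤ a)
    (h : a ≤ (S.filter (d ≤ ·)).card) : a + d ≤ ∑ i ∈ S, (2 * i + 1) := by
  calc a + d ≤ a * (2 * d + 1) := by nlinarith
    _ ≤ (S.filter (d ≤ ·)).card * (2 * d + 1) := Nat.mul_le_mul_right _ h
    _ ≤ ∑ i ∈ S.filter (d ≤ ·), (2 * i + 1) := by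
      rw [← smul_eq_mul]
      refine Finset.card_nsmul_le_sum _ _ _ fun i hi => ?_
      have := (Finset.mem_filter.1 hi).2
      omega
    _ ≤ _ := Finset.sum_le_sum_of_subset (Finset.filter_subset _ _)

lemma le_profileOf_iff {n : ℕ} {S : Finset ℕ} (hS : ∑ i ∈ S, (2 * i + 1) = n) {j k : ℕ}
    (hj : 1 ≤ j) (hk : 1 ≤ k) :
    k ≤ profileOf n S j ↔ min j k ≤ (S.filter (max j k - min j k ≤ ·)).card := by
  refine le_card_filter_Icc_iff
    (p := fun k => min j k ≤ (S.filter (max j k - min j k ≤ ·)).card) (fun a b ha hab hb => ?_)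
    (fun k hk hb => ?_) hk
  · rcases le_total b j with hbj | hbj
    · rw [min_eq_right hbj, max_eq_left hbj] at hb
      rw [min_eq_right (hab.trans hbj), max_eq_left (hab.trans hbj)]
      have := card_filter_le_add S (j - b) (b - a)
      rw [show j - b + (b - a) = j - a by omega] at this
      omega
    · rw [min_eq_left hbj, max_eq_right hbj] at hb
      rcases le_total a j with haj | haj
      · rw [min_eq_right haj, max_eq_left haj]
        have h1 := card_filter_le_add S 0 (j - a)
        have h2 := card_filter_le_anti S (Nat.zero_le (b - j))
        rw [zero_add] at h1
        omega
      · rw [min_eq_left haj, max_eq_right haj]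
        exact hb.trans (card_filter_le_anti S (by omega))
  · have := add_le_sum_of_le_card (by omega) hb
    omega

lemma isSymmProfile_profileOf {n : ℕ} {S : Finset ℕ} (hS : ∑ i ∈ S, (2 * i + 1) = n) :
    IsSymmProfile n (profileOf n S) where
  symm {j k} hj hk h := by
    rw [le_profileOf_iff hS hk hj] at h
    rwa [le_profileOf_iff hS hj hk, min_comm, max_comm]
  le {k} _ := (Finset.card_filter_le _ _).trans (by simp)

lemma diagSet_profileOf {n : ℕ} {S : Finset ℕ} (hS : ∑ i ∈ S, (2 * i + 1) = n) :
    diagSet n (profileOf n S) = S := by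
  ext i
  have key : ∀ j d, 1 ≤ j → (j + d ≤ profileOf n S j ↔ j ≤ (S.filter (d ≤ ·)).card) := by
    intro j d hj
    rw [le_profileOf_iff hS hj (by omega), min_eq_left (by omega), max_eq_right (by omega),
      Nat.add_sub_cancel_left]
  rw [(isSymmProfile_profileOf hS).mem_diagSet]
  have hs := card_filter_le_succ S i
  constructor
  · rintro ⟨j, hj, e⟩
    have h1 := key j i hj
    have h2 := key j (i + 1) hj
    by_contra hi
    rw [if_neg hi] at hs
    omega
  · intro hi
    rw [if_pos hi] at hs
    have hj : 1 ≤ (S.filter (i ≤ ·)).card := by omega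
    refine ⟨_, hj, ?_⟩
    have h1 := key _ i hj
    have h2 := key _ (i + 1) hj
    omega

section Partition

variable {n : ℕ}

lemma colLen_anti (P : n.Partition) {j k : ℕ} (h : j ≤ k) : colLen P k ≤ colLen P j :=
  Multiset.card_le_card (Multiset.monotone_filter_right _ fun _ hp => h.trans hp)

lemma le_rowLen_iff (P : n.Partition) {j k : ℕ} (hj : 1 ≤ j) (hk : 1 ≤ k) :
    k ≤ rowLen P j ↔ j ≤ colLen P k := by
  refine le_card_filter_Icc_iff (p := fun k => j ≤ colLen P k)
    (fun a b _ hab hb => hb.trans (colLen_anti P hab)) (fun k _ hb => ?_) hk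
  obtain ⟨p, hp⟩ := Multiset.card_pos_iff_exists_mem.1 (hj.trans hb)
  rw [Multiset.mem_filter] at hp
  exact hp.2.trans (Nat.Partition.le_of_mem_parts hp.1)

lemma isSymmProfile_colLen {P : n.Partition} (hP : IsSelfConjugate P) :
    IsSymmProfile n (colLen P) where
  symm {j k} hj hk h := by rw [← hP j hj]; exact (le_rowLen_iff P hj hk).2 h
  le {k} hk := by
    rw [← hP k hk]
    exact (Finset.card_filter_le _ _).trans (by simp)

lemma sum_colLen (P : n.Partition) : ∑ k ∈ Finset.Icc 1 n, colLen P k = n := by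
  have h : ∀ s : Multiset ℕ, (∀ p ∈ s, p ≤ n) →
      ∑ k ∈ Finset.Icc 1 n, (s.filter (k ≤ ·)).card = s.sum := by
    intro s
    induction s using Multiset.induction_on with
    | empty => simp
    | cons a s ih =>
      intro hs
      have ha : (Finset.Icc 1 n).filter (· ≤ a) = Finset.Icc 1 a := by
        have := hs a (Multiset.mem_cons_self a s)
        ext k
        simp only [Finset.mem_filter, Finset.mem_Icc]
        omega
      simp only [Multiset.filter_cons, Multiset.card_add, Finset.sum_add_distrib,
        ih fun p hp => hs p (Multiset.mem_cons_of_mem hp), Multiset.sum_cons]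
      simp only [apply_ite Multiset.card, Multiset.card_singleton, Multiset.card_zero]
      rw [← Finset.card_filter, ha, Nat.card_Icc, Nat.add_sub_cancel]
  exact (h P.parts fun p hp => Nat.Partition.le_of_mem_parts hp).trans P.parts_sum

lemma partition_ext_colLen {P P' : n.Partition} (h : ∀ k, 1 ≤ k → colLen P k = colLen P' k) :
    P = P' := by
  have key : ∀ (Q : n.Partition) (k : ℕ), colLen Q k = colLen Q (k + 1) + Q.parts.count k := by
    intro Q k
    rw [colLen, colLen, Multiset.count_eq_card_filter_eq, ← Multiset.card_add]
    congr 1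
    have h0 : Q.parts.filter (fun p => k + 1 ≤ p ∧ k = p) = 0 :=
      Multiset.filter_eq_nil.2 (by intro p _; omega)
    rw [Multiset.filter_add_filter, h0, add_zero]
    refine Multiset.filter_congr fun p _ => ?_
    omega
  refine Nat.Partition.ext (Multiset.ext.2 fun k => ?_)
  rcases Nat.eq_zero_or_pos k with rfl | hk
  · rw [Multiset.count_eq_zero_of_notMem fun h0 => (P.parts_pos h0).false,
      Multiset.count_eq_zero_of_notMem fun h0 => (P'.parts_pos h0).false]
  · have h1 := key P k
    have h2 := key P' k
    rw [h k hk, h (k + 1) (by omega)] at h1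
    omega

lemma exists_partition_of_isSymmProfile {c : ℕ → ℕ} (h : IsSymmProfile n c)
    (hc : ∑ j ∈ Finset.Icc 1 n, c j = n) :
    ∃ P : n.Partition, IsSelfConjugate P ∧ ∀ k, 1 ≤ k → colLen P k = c k := by
  have card_eq : ∀ k, 1 ≤ k → ((Finset.Icc 1 n).filter fun j => k ≤ c j).card = c k := by
    intro k hk
    have : (Finset.Icc 1 n).filter (fun j => k ≤ c j) = Finset.Icc 1 (c k) := by
      ext j
      simp only [Finset.mem_filter, Finset.mem_Icc]
      constructor
      · rintro ⟨hj, hjk⟩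
        exact ⟨hj.1, h.symm hk hj.1 hjk⟩
      · rintro ⟨hj, hjk⟩
        exact ⟨⟨hj, hjk.trans (h.le hk)⟩, h.symm hj hk hjk⟩
    rw [this, Nat.card_Icc, Nat.add_sub_cancel]
  set P := Nat.Partition.ofSums n ((Finset.Icc 1 n).val.map c) hc
  have hcol : ∀ k, 1 ≤ k → colLen P k = c k := by
    intro k hk
    have hparts : P.parts = ((Finset.Icc 1 n).val.map c).filter (· ≠ 0) := rfl
    rw [← card_eq k hk, colLen, hparts, Multiset.filter_filter, Multiset.filter_map,
      Multiset.card_map, Finset.card_def, Finset.filter_val]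
    congr 1
    refine Multiset.filter_congr fun j _ => ?_
    simp only [Function.comp]
    omega
  refine ⟨P, fun k hk => ?_, hcol⟩
  rw [hcol k hk, rowLen, ← card_eq k hk]
  congr 1
  refine Finset.filter_congr fun j hj => ?_
  rw [hcol j (Finset.mem_Icc.1 hj).1]

lemma Nhook_eq_sum {P : n.Partition} (hP : IsSelfConjugate P) (t : ℕ) :
    Nhook t P = ∑ i ∈ diagSet n (colLen P),
      if i < t then (if t - 1 - i ∈ diagSet n (colLen P) then 1 else 0)
      else if i - t ∈ diagSet n (colLen P) then 0 else 2 := by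
  rw [← (isSymmProfile_colLen hP).card_hooks, Nhook]
  congr 1
  refine Finset.filter_congr fun a ha => ?_
  rw [Finset.mem_product, Finset.mem_Icc, Finset.mem_Icc] at ha
  rw [hookNum, hP a.1 ha.1.1]
  omega

lemma sum_diagSet_colLen {P : n.Partition} (hP : IsSelfConjugate P) :
    ∑ i ∈ diagSet n (colLen P), (2 * i + 1) = n := by
  rw [← (isSymmProfile_colLen hP).sum_eq, sum_colLen]

lemma diagonalWeight_diagSet {P : n.Partition} (hP : IsSelfConjugate P) (t : ℕ) (q T : ℂ) :
    diagonalWeight t q T (diagSet n (colLen P)) = T ^ Nhook t P * q ^ n := by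
  rw [diagonalWeight, Finset.prod_mul_distrib, Finset.prod_pow_eq_pow_sum,
    sum_diagSet_colLen hP, Nhook_eq_sum hP, ← Finset.prod_pow_eq_pow_sum, mul_comm]
  congr 1
  refine Finset.prod_congr rfl fun i _ => ?_
  split_ifs <;> simp

/-- Self-conjugate partitions are encoded by their sets of diagonal hook lengths. -/
lemma sum_SC_eq (t n : ℕ) (q T : ℂ) :
    (∑ P ∈ SC n, T ^ Nhook t P) * q ^ n =
      ∑ S ∈ (Finset.range n).powerset.filter (fun S => ∑ i ∈ S, (2 * i + 1) = n),
        diagonalWeight t q T S := by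
  rw [Finset.sum_mul]
  have mem_SC : ∀ {P : n.Partition}, P ∈ SC n ↔ IsSelfConjugate P := by simp [SC]
  refine Finset.sum_bij (fun P _ => diagSet n (colLen P)) ?_ ?_ ?_ ?_
  · intro P hP
    have hs := sum_diagSet_colLen (mem_SC.1 hP)
    rw [Finset.mem_filter, Finset.mem_powerset]
    refine ⟨fun i hi => ?_, hs⟩
    have := Finset.single_le_sum (f := fun i => 2 * i + 1) (fun _ _ => Nat.zero_le _) hi
    simp only [hs] at this
    rw [Finset.mem_range]
    omega
  · intro P hP P' hP' e
    exact partition_ext_colLen fun k hk => (isSymmProfile_colLen (mem_SC.1 hP)).eq_of_diagSet_eq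
      (isSymmProfile_colLen (mem_SC.1 hP')) e hk
  · intro S hS
    rw [Finset.mem_filter] at hS
    have h := isSymmProfile_profileOf hS.2
    have e := diagSet_profileOf hS.2
    obtain ⟨P, hP, hc⟩ := exists_partition_of_isSymmProfile h (by rw [h.sum_eq, e, hS.2])
    refine ⟨P, mem_SC.2 hP, ?_⟩
    ext i
    conv_rhs => rw [← e]
    rw [(isSymmProfile_colLen hP).mem_diagSet, h.mem_diagSet]
    exact exists_congr fun j => and_congr_right fun hj => by rw [hc j hj]
  · intro P hP
    exact (diagonalWeight_diagSet (mem_SC.1 hP) t q T).symm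

end Partition

lemma csqrt_sq (z : ℂ) : csqrt z ^ 2 = z := by
  rw [csqrt, ← Complex.cpow_nat_mul]
  simp

lemma csqrt_ofReal_sq_mul {r : ℝ} (hr : 0 < r) (z : ℂ) : csqrt ((r : ℂ) ^ 2 * z) = r * csqrt z := by
  rcases eq_or_ne z 0 with rfl | hz
  · simp [csqrt]
  · have hr0 : (r : ℂ) ≠ 0 := Complex.ofReal_ne_zero.2 hr.ne'
    rw [csqrt, csqrt, cpow_def_of_ne_zero (mul_ne_zero (pow_ne_zero 2 hr0) hz),
      cpow_def_of_ne_zero hz, ← ofReal_pow, log_ofReal_mul (by positivity) hz, Real.log_pow,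
      add_mul, Complex.exp_add]
    congr 1
    rw [show ((((2 : ℕ) : ℝ) * Real.log r : ℝ) : ℂ) * (1 / 2) = ((Real.log r : ℝ) : ℂ) by
      push_cast; ring, ← ofReal_exp, Real.exp_log hr]

/-- The contribution of the middle runner. -/
lemma eulerSeries_eq_mul_Hstar {T : ℝ} (hT : 0 < T) {z p : ℂ} (hz : ‖z‖ < 1) (hzp : z * z = p) :
    eulerSeries p (1 - (T : ℂ) ^ 2) z +
        ((T : ℂ) - 1) * z * eulerSeries p (1 - (T : ℂ) ^ 2) (z * p) =
      eulerSeries p 0 z * Hstar T z := by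
  set a := csqrt (1 - (T : ℂ) ^ 2) with ha
  have hT0 : (T : ℂ) ≠ 0 := by exact_mod_cast hT.ne'
  have hT1 : (1 + T : ℂ) ≠ 0 := by exact_mod_cast (by positivity : (1 + T : ℝ) ≠ 0)
  have ha2 : a ^ 2 = 1 - (T : ℂ) ^ 2 := csqrt_sq _
  have hc : csqrt ((1 - (T : ℂ)) / (1 + T)) = a / (1 + T) := by
    rw [eq_div_iff hT1, ha, mul_comm]
    have h := csqrt_ofReal_sq_mul (r := 1 + T) (by positivity) ((1 - (T : ℂ)) / (1 + T))
    push_cast at h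
    rw [← h]
    congr 1
    field_simp
    ring
  have h1 := eulerSeries_half hz hzp a
  have h2 := eulerSeries_half hz hzp (-a)
  rw [neg_sq, ha2] at h2
  rw [ha2] at h1
  rw [Hstar, Cp, Cm, hc, pochInf, pochInf, ← ha]
  have key : ∀ X Y : ℂ, eulerSeries p 0 z * (1 / (2 * (T : ℂ)) *
      ((1 + a / (1 + T)) * X + (1 - a / (1 + T)) * Y)) = 1 / (2 * (T : ℂ)) *
      ((1 + a / (1 + T)) * (X * eulerSeries p 0 z) + (1 - a / (1 + T)) * (Y * eulerSeries p 0 z)) :=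
    fun X Y => by ring
  rw [key, ← h1, ← h2]
  field_simp
  linear_combination (2 * (eulerSeries p (1 - (T : ℂ) ^ 2) z -
    z * eulerSeries p (1 - (T : ℂ) ^ 2) (z * p))) * ha2

lemma norm_diagonalWeight_le (t : ℕ) {q : ℂ} (hq : ‖q‖ < 1) (T : ℂ) (S : Finset ℕ) :
    ‖diagonalWeight t q T S‖ ≤ ∏ i ∈ S, (1 + ‖T‖ + ‖T‖ ^ 2) * ‖q‖ ^ i := by
  rw [diagonalWeight, norm_prod]
  refine Finset.prod_le_prod (fun _ _ => norm_nonneg _) fun i _ => ?_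
  rw [norm_mul, norm_pow, mul_comm]
  have h0 := norm_nonneg T
  gcongr ?_ * ?_
  · split_ifs <;> (try rw [norm_pow]) <;> (try rw [norm_one]) <;> nlinarith
  · exact pow_le_pow_of_le_one (norm_nonneg q) hq.le (by omega)

lemma summable_norm_diagonalWeight (t : ℕ) {q : ℂ} (hq : ‖q‖ < 1) (T : ℂ) :
    Summable fun S : Finset ℕ => ‖diagonalWeight t q T S‖ :=
  (summable_finset_prod_geometric (norm_nonneg q) hq (by positivity)).of_nonneg_of_le
    (fun _ => norm_nonneg _) (norm_diagonalWeight_le t hq T)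

lemma hasSum_diagonalWeight (d : ℕ) {q : ℂ} (hq : ‖q‖ < 1) (T : ℂ) :
    HasSum (diagonalWeight (2 * d + 1) q T)
      ((eulerSeries (q ^ (2 * (2 * d + 1))) (1 - T ^ 2) (q ^ (2 * d + 1)) +
        (T - 1) * q ^ (2 * d + 1) * eulerSeries (q ^ (2 * (2 * d + 1))) (1 - T ^ 2)
          (q ^ (2 * d + 1) * q ^ (2 * (2 * d + 1)))) *
        ∏ r : Fin d, ((∏' k : ℕ, (1 - (1 - T ^ 2) * (q ^ (2 * (2 * d + 1))) ^ (k + 1))) *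
          (eulerSeries (q ^ (2 * (2 * d + 1))) 0 (q ^ (2 * (r : ℕ) + 1)) *
            eulerSeries (q ^ (2 * (2 * d + 1))) 0 (q ^ (2 * (2 * d - r) + 1))))) := by
  have hp : ‖q ^ (2 * (2 * d + 1))‖ < 1 := by
    rw [norm_pow]
    exact pow_lt_one₀ (norm_nonneg q) hq (by omega)
  have hs := (summable_norm_diagonalWeight (2 * d + 1) hq T).of_norm
  have hmul : Tendsto (fun m : ℕ => (2 * d + 1) * m) atTop atTop :=
    tendsto_id.const_mul_atTop' (by omega)
  have h1 := hs.hasSum.comp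
    (tendsto_finset_powerset_atTop_atTop.comp (tendsto_finset_range.comp hmul))
  have hw : 1 - (1 - T ^ 2) = T ^ 2 := by ring
  have h2 := tendsto_runnerSum hp (q ^ (2 * d + 1)) T (1 - T ^ 2)
  rw [hw] at h2
  have h3 := h2.mul (tendsto_finsetProd (Finset.univ : Finset (Fin d)) fun r _ =>
    tendsto_runnerPairSum (z := q ^ (2 * (r : ℕ) + 1)) (y := q ^ (2 * (2 * d - r) + 1)) hp
      (by rw [← pow_add]; congr 1; have := r.2; omega) T)
  rw [← tendsto_nhds_unique h1 (h3.congr fun m => (sum_diagonalWeight d m q T).symm)]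
  exact hs.hasSum

lemma prod_eulerSeries_eq (d : ℕ) {q : ℂ} (hq : ‖q‖ < 1) :
    eulerSeries (q ^ (2 * (2 * d + 1))) 0 (q ^ (2 * d + 1)) *
        ∏ r : Fin d, (eulerSeries (q ^ (2 * (2 * d + 1))) 0 (q ^ (2 * (r : ℕ) + 1)) *
          eulerSeries (q ^ (2 * (2 * d + 1))) 0 (q ^ (2 * (2 * d - r) + 1))) =
      ∏' m : ℕ, (1 + q ^ (2 * m + 1)) := by
  have hpow : ∀ {n : ℕ}, n ≠ 0 → ‖q ^ n‖ < 1 := fun hn => by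
    rw [norm_pow]
    exact pow_lt_one₀ (norm_nonneg q) hq hn
  have hp := hpow (n := 2 * (2 * d + 1)) (by omega)
  have hmul : Tendsto (fun m : ℕ => (2 * d + 1) * m) atTop atTop :=
    tendsto_id.const_mul_atTop' (by omega)
  have e : ∀ m : ℕ, 1 + q ^ (2 * m + 1) = 1 + q * (q ^ 2) ^ m := fun m => by ring
  have h1 := (tendsto_prod_one_add_mul_pow (hpow two_ne_zero) q).comp hmul
  simp only [← e] at h1
  rw [← prod_range_odd_eq d fun r => eulerSeries (q ^ (2 * (2 * d + 1))) 0 (q ^ (2 * r + 1))]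
  have h2 := tendsto_finsetProd (Finset.range (2 * d + 1)) fun r _ =>
    tendsto_prod_one_add_mul_pow hp (q ^ (2 * r + 1))
  simp only [← eulerSeries_eq_tprod hp] at h2
  refine tendsto_nhds_unique h2 (h1.congr fun m => ?_)
  simp only [Function.comp]
  rw [prod_range_mul_eq]
  refine Finset.prod_congr rfl fun r _ => Finset.prod_congr rfl fun k _ => ?_
  ring

lemma mem_range_powerset_filter {n : ℕ} {S : Finset ℕ} :
    S ∈ (Finset.range n).powerset.filter (fun S => ∑ i ∈ S, (2 * i + 1) = n) ↔
      ∑ i ∈ S, (2 * i + 1) = n := by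
  rw [Finset.mem_filter, Finset.mem_powerset, and_iff_right_iff_imp]
  intro hs i hi
  have := Finset.single_le_sum (f := fun i => 2 * i + 1) (fun _ _ => Nat.zero_le _) hi
  simp only [hs] at this
  rw [Finset.mem_range]
  omega

/-- Sums over all finite sets can be grouped by the size `∑ (2i+1)` of the diagram. -/
lemma hasSum_sum_diagonal_fiber {F : Finset ℕ → ℂ} {a : ℂ}
    (hs : Summable fun S => ‖F S‖) (h : HasSum F a) :
    Summable (fun n : ℕ => ‖∑ S ∈ (Finset.range n).powerset.filter
      (fun S => ∑ i ∈ S, (2 * i + 1) = n), F S‖) ∧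
    HasSum (fun n : ℕ => ∑ S ∈ (Finset.range n).powerset.filter
      (fun S => ∑ i ∈ S, (2 * i + 1) = n), F S) a := by
  have fib : ∀ {E : Type} [NormedAddCommGroup E] (G : Finset ℕ → E) (n : ℕ),
      HasSum (fun S : (fun S : Finset ℕ => ∑ i ∈ S, (2 * i + 1)) ⁻¹' {n} => G S)
        (∑ S ∈ (Finset.range n).powerset.filter (fun S => ∑ i ∈ S, (2 * i + 1) = n), G S) := by
    intro E _ G n
    have := Finset.hasSum ((Finset.range n).powerset.filter
      (fun S => ∑ i ∈ S, (2 * i + 1) = n)) G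
    have e : (fun S : Finset ℕ => ∑ i ∈ S, (2 * i + 1)) ⁻¹' {n} =
        ((Finset.range n).powerset.filter (fun S => ∑ i ∈ S, (2 * i + 1) = n) :
          Set (Finset ℕ)) := by
      ext S
      exact mem_range_powerset_filter.symm
    rw [e]
    exact this
  have main : ∀ {E : Type} [NormedAddCommGroup E] {G : Finset ℕ → E} {b : E}, HasSum G b →
      HasSum (fun n : ℕ => ∑ S ∈ (Finset.range n).powerset.filter
        (fun S => ∑ i ∈ S, (2 * i + 1) = n), G S) b := fun {E} _ {G} {b} hG =>
    ((Equiv.sigmaFiberEquiv fun S : Finset ℕ => ∑ i ∈ S, (2 * i + 1)).hasSum_iff.2 hG).sigma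
      (fib G)
  exact ⟨(main hs.hasSum).summable.of_nonneg_of_le (fun _ => norm_nonneg _)
    fun _ => norm_sum_le _ _, main h⟩

/-- Generating function for `sc_t(n;T)` when `t` is odd:
`Σ_{n≥0} sc_t(n;T) qⁿ = (-q;q²)_∞ · H*(T;qᵗ) · ((1-T²)q^{2t}; q^{2t})_∞^{(t-1)/2}`. -/
theorem stmt3 (t : ℕ) (ht : 1 ≤ t) (hto : Odd t) (T : ℝ) (hT : 0 < T)
    (q : ℂ) (hq : ‖q‖ < 1) :
    Summable (fun n : ℕ => ‖(∑ P ∈ SC n, (T:ℂ) ^ Nhook t P) * q ^ n‖) ∧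
    ∑' n : ℕ, (∑ P ∈ SC n, (T:ℂ) ^ Nhook t P) * q ^ n =
      (∏' m : ℕ, (1 + q ^ (2*m+1))) * Hstar T (q^t) *
        ∏' m : ℕ, (1 - (1 - (T:ℂ)^2) * q ^ (2*t*(m+1))) ^ ((t-1)/2) := by
  obtain ⟨d, rfl⟩ := hto
  have hd : (2 * d + 1 - 1) / 2 = d := by omega
  have hz : ‖q ^ (2 * d + 1)‖ < 1 := by
    rw [norm_pow]
    exact pow_lt_one₀ (norm_nonneg q) hq (by omega)
  have hp : ‖q ^ (2 * (2 * d + 1))‖ < 1 := by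
    rw [norm_pow]
    exact pow_lt_one₀ (norm_nonneg q) hq (by omega)
  have h := hasSum_sum_diagonal_fiber (summable_norm_diagonalWeight (2 * d + 1) hq T)
    (hasSum_diagonalWeight d hq T)
  simp only [← sum_SC_eq] at h
  refine ⟨h.1, h.2.tsum_eq.trans ?_⟩
  have hm : Multipliable fun m : ℕ => 1 - (1 - (T : ℂ) ^ 2) * q ^ (2 * (2 * d + 1) * (m + 1)) := by
    refine (multipliable_one_add_mul_pow hp
      (-(1 - (T : ℂ) ^ 2) * q ^ (2 * (2 * d + 1)))).congr fun m => ?_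
    rw [pow_mul q (2 * (2 * d + 1)) (m + 1)]
    ring
  rw [eulerSeries_eq_mul_Hstar hT hz (by rw [← pow_add]; ring_nf), hd, hm.tprod_pow,
    ← prod_eulerSeries_eq d hq, Finset.prod_mul_distrib, Finset.prod_const, Finset.card_univ,
    Fintype.card_fin]
  simp only [← pow_mul q]
  ring
end
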